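/- arXiv:1003.4137 — 2 statements merged into one kernel-verified Lean document; each statement's English description precedes it below -/
import Mathlib

section
/- Let S⁰ be a quasi-ideal adequate transversal of an abundant semigroup S. Then there exist a left adequate semigroup L and a right adequate semigroup R having S⁰ as a common quasi-ideal adequate transversal such that S is isomorphic to the spined product T = {(x,a) ∈ L × R : x̄ = ā} with multiplication (x,a)(y,b) = (e_x a y, a y f_b), and T⁰ = {(s,s) : s ∈ S⁰} is a quasi-ideal adequate transversal of T isomorphic to S⁰. -/
/-!
Common framework: "relative" semigroup-theoretic notions.  All notions are taken
relative to a carrier set `U` inside an ambient type, together with an explicit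
binary operation `mul` (only the values of `mul` on `U` are relevant).  For an
honest semigroup `S` one takes `U = Set.univ` and `mul = mulOf S`.

* `RStarOn mul U a b` : the relation `a ℛ* b` computed in `U` with an identity
  adjoined (the two clauses correspond to multipliers from `U` and to the
  adjoined identity).
* `LStarOn`, `GreenLOn`, `GreenROn` : dual / Green's relations.
* `AbundantOn`, `AdequateOn`, `LeftAdequateOn`, `RightAdequateOn`.
* `AdequateTransversalOn mul U S0` : `S0` is an adequate `*`-subsemigroup of `U`
  which is an adequate transversal, with the data `bar x = x̄`, `e x = e_x`,
  `f x = f_x`, and `plus s = s⁺`, `star s = s⋆` for `s ∈ S0`.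
* `InverseTransversalOn mul U S0` : `S0` is an inverse transversal of the
  regular semigroup `U`, with `o x = x⁰` the unique inverse of `x` in `S0`.
-/

namespace Paper

universe u

variable {α : Type*} {β : Type*} {γ : Type*}

def mulOf (α : Type*) [Mul α] : α → α → α := fun a b => a * b

/-- `x` is an idempotent for the operation `mul`. -/
def Idem (mul : α → α → α) (x : α) : Prop := mul x x = x

/-- The relation `ℛ*` on `U` (with an identity adjoined to `U`). -/
def RStarOn (mul : α → α → α) (U : Set α) (a b : α) : Prop :=
  (∀ x ∈ U, ∀ y ∈ U, (mul x a = mul y a ↔ mul x b = mul y b)) ∧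
  (∀ x ∈ U, (mul x a = a ↔ mul x b = b))

/-- The relation `ℒ*` on `U` (with an identity adjoined to `U`). -/
def LStarOn (mul : α → α → α) (U : Set α) (a b : α) : Prop :=
  (∀ x ∈ U, ∀ y ∈ U, (mul a x = mul a y ↔ mul b x = mul b y)) ∧
  (∀ x ∈ U, (mul a x = a ↔ mul b x = b))

/-- Green's relation `ℒ` on `U`: `U¹ a = U¹ b`. -/
def GreenLOn (mul : α → α → α) (U : Set α) (a b : α) : Prop :=
  (a = b ∨ ∃ u ∈ U, mul u b = a) ∧ (b = a ∨ ∃ v ∈ U, mul v a = b)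

/-- Green's relation `ℛ` on `U`: `a U¹ = b U¹`. -/
def GreenROn (mul : α → α → α) (U : Set α) (a b : α) : Prop :=
  (a = b ∨ ∃ u ∈ U, mul b u = a) ∧ (b = a ∨ ∃ v ∈ U, mul a v = b)

/-- `U` is closed under `mul`. -/
def ClosedOn (mul : α → α → α) (U : Set α) : Prop :=
  ∀ a ∈ U, ∀ b ∈ U, mul a b ∈ U

/-- `U` with the operation `mul` is a semigroup. -/
def SemigroupOn (mul : α → α → α) (U : Set α) : Prop :=
  ClosedOn mul U ∧ ∀ a ∈ U, ∀ b ∈ U, ∀ c ∈ U, mul (mul a b) c = mul a (mul b c)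

/-- Every `ℛ*`-class and every `ℒ*`-class of `U` contains an idempotent. -/
def AbundantOn (mul : α → α → α) (U : Set α) : Prop :=
  ∀ a ∈ U, (∃ e ∈ U, Idem mul e ∧ RStarOn mul U a e) ∧
           (∃ f ∈ U, Idem mul f ∧ LStarOn mul U a f)

/-- Abundant with commuting idempotents. -/
def AdequateOn (mul : α → α → α) (U : Set α) : Prop :=
  AbundantOn mul U ∧
    ∀ u ∈ U, ∀ v ∈ U, Idem mul u → Idem mul v → mul u v = mul v u

/-- Abundant, and every `ℛ*`-class contains a unique idempotent. -/
def LeftAdequateOn (mul : α → α → α) (U : Set α) : Prop :=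
  AbundantOn mul U ∧
    ∀ u ∈ U, ∀ v ∈ U, Idem mul u → Idem mul v → RStarOn mul U u v → u = v

/-- Abundant, and every `ℒ*`-class contains a unique idempotent. -/
def RightAdequateOn (mul : α → α → α) (U : Set α) : Prop :=
  AbundantOn mul U ∧
    ∀ u ∈ U, ∀ v ∈ U, Idem mul u → Idem mul v → LStarOn mul U u v → u = v

/-- `S0` is a quasi-ideal of `U` : `S0 U S0 ⊆ S0`. -/
def QuasiIdealOn (mul : α → α → α) (U S0 : Set α) : Prop :=
  ∀ s ∈ S0, ∀ x ∈ U, ∀ t ∈ S0, mul (mul s x) t ∈ S0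

/-- Every element of `U` has an inverse in `U`. -/
def RegularOn (mul : α → α → α) (U : Set α) : Prop :=
  ∀ x ∈ U, ∃ u ∈ U, mul (mul x u) x = x ∧ mul (mul u x) u = u

/-- Regular with commuting idempotents, i.e. an inverse semigroup. -/
def InverseSgpOn (mul : α → α → α) (U : Set α) : Prop :=
  RegularOn mul U ∧
    ∀ u ∈ U, ∀ v ∈ U, Idem mul u → Idem mul v → mul u v = mul v u

/-- Regular, and every Green `ℛ`-class contains a unique idempotent. -/
def LeftInverseSgpOn (mul : α → α → α) (U : Set α) : Prop :=
  RegularOn mul U ∧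
    ∀ u ∈ U, ∀ v ∈ U, Idem mul u → Idem mul v → GreenROn mul U u v → u = v

/-- Regular, and every Green `ℒ`-class contains a unique idempotent. -/
def RightInverseSgpOn (mul : α → α → α) (U : Set α) : Prop :=
  RegularOn mul U ∧
    ∀ u ∈ U, ∀ v ∈ U, Idem mul u → Idem mul v → GreenLOn mul U u v → u = v

/-- An isomorphism from `(A, mulA)` onto `(B, mulB)`. -/
def IsoOn (mulA : α → α → α) (mulB : β → β → β) (A : Set α) (B : Set β) : Prop :=
  ∃ θ : α → β, Set.BijOn θ A B ∧ ∀ a ∈ A, ∀ b ∈ A, θ (mulA a b) = mulB (θ a) (θ b)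

/-- `S0` is an adequate transversal of the abundant semigroup `U`.  `S0` is an
adequate `*`-subsemigroup of `U` (witnessed by `plus`/`star`, the canonical
idempotents `a⁺ ℛ* a`, `a⋆ ℒ* a` of elements of `S0`, the `ℛ*`/`ℒ*` relations
being those of the big semigroup `U`, which gives the `*`-subsemigroup property),
and every `x ∈ U` factors uniquely as `x = e_x x̄ f_x` with `x̄ ∈ S0`,
`e_x, f_x` idempotents of `U`, `e_x ℒ x̄⁺` and `f_x ℛ x̄⋆`. -/
structure AdequateTransversalOn (mul : α → α → α) (U S0 : Set α) where
  sub : S0 ⊆ U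
  mul_mem : ∀ a ∈ S0, ∀ b ∈ S0, mul a b ∈ S0
  bar : α → α
  e : α → α
  f : α → α
  plus : α → α
  star : α → α
  plus_mem : ∀ a ∈ S0, plus a ∈ S0
  plus_idem : ∀ a ∈ S0, Idem mul (plus a)
  plus_rstar : ∀ a ∈ S0, RStarOn mul U a (plus a)
  star_mem : ∀ a ∈ S0, star a ∈ S0
  star_idem : ∀ a ∈ S0, Idem mul (star a)
  star_lstar : ∀ a ∈ S0, LStarOn mul U a (star a)
  idem_comm : ∀ u ∈ S0, ∀ v ∈ S0, Idem mul u → Idem mul v → mul u v = mul v u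
  bar_mem : ∀ x ∈ U, bar x ∈ S0
  e_mem : ∀ x ∈ U, e x ∈ U
  f_mem : ∀ x ∈ U, f x ∈ U
  e_idem : ∀ x ∈ U, Idem mul (e x)
  f_idem : ∀ x ∈ U, Idem mul (f x)
  decomp : ∀ x ∈ U, x = mul (mul (e x) (bar x)) (f x)
  e_greenL : ∀ x ∈ U, GreenLOn mul U (e x) (plus (bar x))
  f_greenR : ∀ x ∈ U, GreenROn mul U (f x) (star (bar x))
  unique : ∀ x ∈ U, ∀ s ∈ S0, ∀ e' ∈ U, ∀ f' ∈ U, Idem mul e' → Idem mul f' →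
      x = mul (mul e' s) f' → GreenLOn mul U e' (plus s) → GreenROn mul U f' (star s) →
      s = bar x ∧ e' = e x ∧ f' = f x

namespace AdequateTransversalOn

variable {mul : α → α → α} {U S0 : Set α}

/-- `R = {x ∈ U : e_x = e_{x̄}}`. -/
def Rset (T : AdequateTransversalOn mul U S0) : Set α :=
  {x | x ∈ U ∧ T.e x = T.e (T.bar x)}

/-- `L = {x ∈ U : f_x = f_{x̄}}`. -/
def Lset (T : AdequateTransversalOn mul U S0) : Set α :=
  {x | x ∈ U ∧ T.f x = T.f (T.bar x)}

/-- `I = {e_x : x ∈ U}`. -/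
def Iset (T : AdequateTransversalOn mul U S0) : Set α :=
  {y | ∃ x ∈ U, T.e x = y}

/-- `Λ = {f_x : x ∈ U}`. -/
def LamSet (T : AdequateTransversalOn mul U S0) : Set α :=
  {y | ∃ x ∈ U, T.f x = y}

/-- The transversal is multiplicative: `Λ I ⊆ E⁰`. -/
def IsMultiplicative (T : AdequateTransversalOn mul U S0) : Prop :=
  ∀ l ∈ T.LamSet, ∀ i ∈ T.Iset, mul l i ∈ S0 ∧ Idem mul (mul l i)

end AdequateTransversalOn

/-- The spined product set `T = L |×| R ⊆ S × S` attached to an adequate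
transversal of `S` (ambient carrier `U`). -/
def spSet {mul : α → α → α} {U S0 : Set α}
    (T : AdequateTransversalOn mul U S0) : Set (α × α) :=
  {p | p.1 ∈ T.Lset ∧ p.2 ∈ T.Rset ∧ T.bar p.1 = T.bar p.2}

/-- The multiplication `(x,a)(y,b) = (e_x(ay), (ay) f_b)` on the spined product. -/
def spMul {mul : α → α → α} {U S0 : Set α}
    (T : AdequateTransversalOn mul U S0) : α × α → α × α → α × α :=
  fun p q => (mul (T.e p.1) (mul p.2 q.1), mul (mul p.2 q.1) (T.f q.2))

/-- The map `φ : S → T`, `x ↦ (e_x x̄, x̄ f_x)`. -/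
def phiMap {mul : α → α → α} {U S0 : Set α}
    (T : AdequateTransversalOn mul U S0) : α → α × α :=
  fun x => (mul (T.e x) (T.bar x), mul (T.bar x) (T.f x))

/-- `T⁰ = {(s,s) : s ∈ S0}`. -/
def diagSet (S0 : Set α) : Set (α × α) := {p | ∃ s ∈ S0, p = (s, s)}

/-- Abstract spined product `L |×| R` over a common transversal `S⁰` (a type `γ`
embedded into `L` and `R` by `jL`, `jR`). -/
def absTset {mulL : α → α → α} {mulR : β → β → β} {jL : γ → α} {jR : γ → β}
    (TL : AdequateTransversalOn mulL Set.univ (Set.range jL))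
    (TR : AdequateTransversalOn mulR Set.univ (Set.range jR)) : Set (α × β) :=
  {p | ∃ s : γ, jL s = TL.bar p.1 ∧ jR s = TR.bar p.2}

/-- The multiplication `(x,a)(y,b) = (e_x(a∗y), (a∗y) f_b)`. -/
def absMul {mulL : α → α → α} {mulR : β → β → β} {jL : γ → α} {jR : γ → β}
    (TL : AdequateTransversalOn mulL Set.univ (Set.range jL))
    (TR : AdequateTransversalOn mulR Set.univ (Set.range jR))
    (st : β → α → γ) : α × β → α × β → α × β :=
  fun p q => (mulL (TL.e p.1) (jL (st p.2 q.1)), mulR (jR (st p.2 q.1)) (TR.f q.2))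

/-- `T⁰ = {(s,s) : s ∈ S⁰}` inside `L × R`, where `s` is viewed in `L` and in `R`. -/
def absT0 (jL : γ → α) (jR : γ → β) : Set (α × β) :=
  {p | ∃ s : γ, p = (jL s, jR s)}

/-- `S0` is an inverse transversal of the regular semigroup `U`: an inverse
subsemigroup meeting the set of inverses of each `x ∈ U` in exactly one
element `o x = x⁰`. -/
structure InverseTransversalOn (mul : α → α → α) (U S0 : Set α) where
  sub : S0 ⊆ U
  mul_mem : ∀ a ∈ S0, ∀ b ∈ S0, mul a b ∈ S0
  o : α → α
  o_mem : ∀ x ∈ U, o x ∈ S0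
  o_inv1 : ∀ x ∈ U, mul (mul x (o x)) x = x
  o_inv2 : ∀ x ∈ U, mul (mul (o x) x) (o x) = o x
  o_unique : ∀ x ∈ U, ∀ u ∈ S0, mul (mul x u) x = x → mul (mul u x) u = u → u = o x
  idem_comm : ∀ u ∈ S0, ∀ v ∈ S0, Idem mul u → Idem mul v → mul u v = mul v u

namespace InverseTransversalOn

variable {mul : α → α → α} {U S0 : Set α}

/-- `L = {x ∈ U : x⁰x ∈ E⁰}`. -/
def LsetI (T : InverseTransversalOn mul U S0) : Set α :=
  {x | x ∈ U ∧ mul (T.o x) x ∈ S0 ∧ Idem mul (mul (T.o x) x)}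

/-- `R = {x ∈ U : xx⁰ ∈ E⁰}`. -/
def RsetI (T : InverseTransversalOn mul U S0) : Set α :=
  {x | x ∈ U ∧ mul x (T.o x) ∈ S0 ∧ Idem mul (mul x (T.o x))}

end InverseTransversalOn

/-- Spined product set for an inverse transversal: `{(x,a) : x⁰ = a⁰}`. -/
def invSpSet {mul : α → α → α} {U S0 : Set α}
    (T : InverseTransversalOn mul U S0) : Set (α × α) :=
  {p | p.1 ∈ T.LsetI ∧ p.2 ∈ T.RsetI ∧ T.o p.1 = T.o p.2}

/-- The multiplication `(x,a)(y,b) = ((xx⁰)(ay), (ay)(b⁰b))`. -/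
def invSpMul {mul : α → α → α} {U S0 : Set α}
    (T : InverseTransversalOn mul U S0) : α × α → α × α → α × α :=
  fun p q => (mul (mul p.1 (T.o p.1)) (mul p.2 q.1),
              mul (mul p.2 q.1) (mul (T.o q.2) q.2))

/-- Abstract spined product for inverse transversals: `{(x,a) : x⁰ = a⁰}`. -/
def invAbsTset {mulL : α → α → α} {mulR : β → β → β} {jL : γ → α} {jR : γ → β}
    (TL : InverseTransversalOn mulL Set.univ (Set.range jL))
    (TR : InverseTransversalOn mulR Set.univ (Set.range jR)) : Set (α × β) :=
  {p | ∃ s : γ, jL s = TL.o p.1 ∧ jR s = TR.o p.2}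

/-- The multiplication `(x,a)(y,b) = ((xx⁰)(a∗y), (a∗y)(b⁰b))`. -/
def invAbsMul {mulL : α → α → α} {mulR : β → β → β} {jL : γ → α} {jR : γ → β}
    (TL : InverseTransversalOn mulL Set.univ (Set.range jL))
    (TR : InverseTransversalOn mulR Set.univ (Set.range jR))
    (st : β → α → γ) : α × β → α × β → α × β :=
  fun p q => (mulL (mulL p.1 (TL.o p.1)) (jL (st p.2 q.1)),
              mulR (jR (st p.2 q.1)) (mulR (TR.o q.2) q.2))

/-- The multiplication `(e,x)(g,w) = (e(aa⁻¹), a)`, `a = x((x⁻¹x)g)w`, on `I × S⁰`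
(Chen-style construction from a left normal band `I` with semilattice transversal
`E⁰ = E(S⁰)`; `σ` embeds idempotents of the inverse semigroup `γ` into the band
`β`, and `π : β → γ` is the semilattice-transversal map `e ↦ e⁰`). -/
def bandMul (mulB : β → β → β) (mulG : γ → γ → γ) (σ : γ → β) (π : β → γ)
    (inv : γ → γ) (p q : β × γ) : β × γ :=
  let a := mulG (mulG p.2 (π (mulB (σ (mulG (inv p.2) p.2)) q.1))) q.2
  (mulB p.1 (σ (mulG a (inv a))), a)

/-- `T = {(e,x) : e⁰ = xx⁻¹}`. -/
def bandTset (mulG : γ → γ → γ) (π : β → γ) (inv : γ → γ) : Set (β × γ) :=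
  {p | π p.1 = mulG p.2 (inv p.2)}

/-- `T⁰ = {(aa⁻¹, a) : a ∈ S⁰}` (with `aa⁻¹` viewed in the band via `σ`). -/
def bandT0 (mulG : γ → γ → γ) (σ : γ → β) (inv : γ → γ) : Set (β × γ) :=
  {p | ∃ s : γ, p = (σ (mulG s (inv s)), s)}

end Paper

namespace Paper

open Set

theorem RStarOn.mono {α : Type*} {mul : α → α → α} {U V : Set α} {a b : α}
    (h : RStarOn mul U a b) (hVU : V ⊆ U) : RStarOn mul V a b :=
  ⟨fun x hx y hy => h.1 x (hVU hx) y (hVU hy), fun x hx => h.2 x (hVU hx)⟩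

theorem LStarOn.mono {α : Type*} {mul : α → α → α} {U V : Set α} {a b : α}
    (h : LStarOn mul U a b) (hVU : V ⊆ U) : LStarOn mul V a b :=
  ⟨fun x hx y hy => h.1 x (hVU hx) y (hVU hy), fun x hx => h.2 x (hVU hx)⟩

theorem GreenLOn.mono {α : Type*} {mul : α → α → α} {U V : Set α} {a b : α}
    (h : GreenLOn mul V a b) (hVU : V ⊆ U) : GreenLOn mul U a b :=
  ⟨h.1.imp id fun ⟨u, hu, hh⟩ => ⟨u, hVU hu, hh⟩, h.2.imp id fun ⟨u, hu, hh⟩ => ⟨u, hVU hu, hh⟩⟩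

theorem GreenROn.mono {α : Type*} {mul : α → α → α} {U V : Set α} {a b : α}
    (h : GreenROn mul V a b) (hVU : V ⊆ U) : GreenROn mul U a b :=
  ⟨h.1.imp id fun ⟨u, hu, hh⟩ => ⟨u, hVU hu, hh⟩, h.2.imp id fun ⟨u, hu, hh⟩ => ⟨u, hVU hu, hh⟩⟩

theorem QuasiIdealOn.mono {α : Type*} {mul : α → α → α} {U V S0 : Set α}
    (h : QuasiIdealOn mul U S0) (hVU : V ⊆ U) : QuasiIdealOn mul V S0 :=
  fun s hs x hx t ht => h s hs x (hVU hx) t ht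

section Semigroup

variable {S : Type*} [Semigroup S]

theorem mulOf_apply (a b : S) : mulOf S a b = a * b := rfl

theorem greenLOn_univ_iff {a b : S} (ha : a * a = a) (hb : b * b = b) :
    GreenLOn (mulOf S) univ a b ↔ a * b = a ∧ b * a = b := by
  constructor
  · rintro ⟨h1, h2⟩
    constructor
    · rcases h1 with rfl | ⟨u, -, rfl⟩
      · exact ha
      · simp only [mulOf, mul_assoc, hb]
    · rcases h2 with rfl | ⟨u, -, rfl⟩
      · exact hb
      · simp only [mulOf, mul_assoc, ha]
  · rintro ⟨h1, h2⟩
    exact ⟨Or.inr ⟨a, mem_univ _, h1⟩, Or.inr ⟨b, mem_univ _, h2⟩⟩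

theorem greenROn_univ_iff {a b : S} (ha : a * a = a) (hb : b * b = b) :
    GreenROn (mulOf S) univ a b ↔ b * a = a ∧ a * b = b := by
  constructor
  · rintro ⟨h1, h2⟩
    constructor
    · rcases h1 with rfl | ⟨u, -, rfl⟩
      · exact ha
      · simp only [mulOf, ← mul_assoc, hb]
    · rcases h2 with rfl | ⟨u, -, rfl⟩
      · exact hb
      · simp only [mulOf, ← mul_assoc, ha]
  · rintro ⟨h1, h2⟩
    exact ⟨Or.inr ⟨a, mem_univ _, h1⟩, Or.inr ⟨b, mem_univ _, h2⟩⟩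

theorem RStarOn.mul_eq_iff {a b : S} (h : RStarOn (mulOf S) univ a b) (x y : S) :
    x * a = y * a ↔ x * b = y * b :=
  h.1 x (mem_univ _) y (mem_univ _)

theorem RStarOn.mul_eq_self_iff {a b : S} (h : RStarOn (mulOf S) univ a b) (x : S) :
    x * a = a ↔ x * b = b :=
  h.2 x (mem_univ _)

theorem LStarOn.mul_eq_iff {a b : S} (h : LStarOn (mulOf S) univ a b) (x y : S) :
    a * x = a * y ↔ b * x = b * y :=
  h.1 x (mem_univ _) y (mem_univ _)

theorem LStarOn.mul_eq_self_iff {a b : S} (h : LStarOn (mulOf S) univ a b) (x : S) :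
    a * x = a ↔ b * x = b :=
  h.2 x (mem_univ _)

namespace AdequateTransversalOn

variable {S0 : Set S} (T : AdequateTransversalOn (mulOf S) univ S0)

theorem plus_mul_plus {s : S} (hs : s ∈ S0) : T.plus s * T.plus s = T.plus s :=
  T.plus_idem s hs

theorem star_mul_star {s : S} (hs : s ∈ S0) : T.star s * T.star s = T.star s :=
  T.star_idem s hs

theorem plus_mul {s : S} (hs : s ∈ S0) : T.plus s * s = s :=
  ((T.plus_rstar s hs).mul_eq_self_iff _).2 (T.plus_mul_plus hs)

theorem mul_star {s : S} (hs : s ∈ S0) : s * T.star s = s :=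
  ((T.star_lstar s hs).mul_eq_self_iff _).2 (T.star_mul_star hs)

theorem bar_mem' (x : S) : T.bar x ∈ S0 := T.bar_mem x (mem_univ _)

theorem e_mul_e (x : S) : T.e x * T.e x = T.e x := T.e_idem x (mem_univ _)

theorem f_mul_f (x : S) : T.f x * T.f x = T.f x := T.f_idem x (mem_univ _)

theorem e_mul_plus (x : S) : T.e x * T.plus (T.bar x) = T.e x :=
  ((greenLOn_univ_iff (T.e_mul_e x) (T.plus_mul_plus (T.bar_mem' x))).1
    (T.e_greenL x (mem_univ _))).1

theorem plus_mul_e (x : S) : T.plus (T.bar x) * T.e x = T.plus (T.bar x) :=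
  ((greenLOn_univ_iff (T.e_mul_e x) (T.plus_mul_plus (T.bar_mem' x))).1
    (T.e_greenL x (mem_univ _))).2

theorem star_mul_f (x : S) : T.star (T.bar x) * T.f x = T.f x :=
  ((greenROn_univ_iff (T.f_mul_f x) (T.star_mul_star (T.bar_mem' x))).1
    (T.f_greenR x (mem_univ _))).1

theorem f_mul_star (x : S) : T.f x * T.star (T.bar x) = T.star (T.bar x) :=
  ((greenROn_univ_iff (T.f_mul_f x) (T.star_mul_star (T.bar_mem' x))).1
    (T.f_greenR x (mem_univ _))).2

theorem eq_mul (x : S) : T.e x * T.bar x * T.f x = x := (T.decomp x (mem_univ _)).symm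

theorem decomp_unique {s g h : S} (hs : s ∈ S0)
    (hg1 : g * T.plus s = g) (hg2 : T.plus s * g = T.plus s)
    (hh1 : T.star s * h = h) (hh2 : h * T.star s = T.star s) :
    T.bar (g * s * h) = s ∧ T.e (g * s * h) = g ∧ T.f (g * s * h) = h := by
  have hg : g * g = g := by
    calc g * g = g * T.plus s * g := by rw [hg1]
      _ = g := by rw [mul_assoc, hg2, hg1]
  have hh : h * h = h := by
    calc h * h = h * (T.star s * h) := by rw [hh1]
      _ = h := by rw [← mul_assoc, hh2, hh1]
  obtain ⟨h1, h2, h3⟩ := T.unique (g * s * h) (mem_univ _) s hs g (mem_univ _) h (mem_univ _) hg hh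
    rfl ((greenLOn_univ_iff hg (T.plus_mul_plus hs)).2 ⟨hg1, hg2⟩)
    ((greenROn_univ_iff hh (T.star_mul_star hs)).2 ⟨hh1, hh2⟩)
  exact ⟨h1.symm, h2.symm, h3.symm⟩

/-- The decomposition data of an element `g s` with `g ℒ s⁺`. -/
theorem decomp_unique_left {s g : S} (hs : s ∈ S0)
    (hg1 : g * T.plus s = g) (hg2 : T.plus s * g = T.plus s) :
    T.bar (g * s) = s ∧ T.e (g * s) = g ∧ T.f (g * s) = T.star s := by
  have := T.decomp_unique hs hg1 hg2 (T.star_mul_star hs) (T.star_mul_star hs)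
  rwa [mul_assoc g s, T.mul_star hs] at this

/-- The decomposition data of an element `s h` with `h ℛ s⋆`. -/
theorem decomp_unique_right {s h : S} (hs : s ∈ S0)
    (hh1 : T.star s * h = h) (hh2 : h * T.star s = T.star s) :
    T.bar (s * h) = s ∧ T.e (s * h) = T.plus s ∧ T.f (s * h) = h := by
  have := T.decomp_unique hs (T.plus_mul_plus hs) (T.plus_mul_plus hs) hh1 hh2
  rwa [T.plus_mul hs] at this

theorem decomp_of_mem {s : S} (hs : s ∈ S0) :
    T.bar s = s ∧ T.e s = T.plus s ∧ T.f s = T.star s := by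
  have := T.decomp_unique_left hs (T.plus_mul_plus hs) (T.plus_mul_plus hs)
  rwa [T.plus_mul hs] at this

theorem plus_eq_self {p : S} (hp : p ∈ S0) (hpp : p * p = p) : T.plus p = p := by
  have h1 : p * T.plus p = T.plus p := ((T.plus_rstar p hp).mul_eq_self_iff _).1 hpp
  have h2 : p * T.plus p = T.plus p * p :=
    T.idem_comm p hp _ (T.plus_mem p hp) hpp (T.plus_idem p hp)
  rw [← h1, h2, T.plus_mul hp]

theorem star_eq_self {p : S} (hp : p ∈ S0) (hpp : p * p = p) : T.star p = p := by
  have h1 : T.star p * p = T.star p := ((T.star_lstar p hp).mul_eq_self_iff _).1 hpp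
  have h2 : p * T.star p = T.star p * p :=
    T.idem_comm p hp _ (T.star_mem p hp) hpp (T.star_idem p hp)
  rw [← h1, ← h2, T.mul_star hp]

/-- The transversal viewed in the opposite semigroup. -/
def dual : AdequateTransversalOn (fun a b : S => b * a) univ S0 where
  sub := T.sub
  mul_mem a ha b hb := T.mul_mem b hb a ha
  bar := T.bar
  e := T.f
  f := T.e
  plus := T.star
  star := T.plus
  plus_mem := T.star_mem
  plus_idem := T.star_idem
  plus_rstar := T.star_lstar
  star_mem := T.plus_mem
  star_idem := T.plus_idem
  star_lstar := T.plus_rstar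
  idem_comm u hu v hv hu' hv' := T.idem_comm v hv u hu hv' hu'
  bar_mem := T.bar_mem
  e_mem := T.f_mem
  f_mem := T.e_mem
  e_idem := T.f_idem
  f_idem := T.e_idem
  decomp x hx := (T.decomp x hx).trans (mul_assoc _ _ _)
  e_greenL := T.f_greenR
  f_greenR := T.e_greenL
  unique x hx s hs e' he' f' hf' hei hfi hdec hL hR := by
    obtain ⟨h1, h2, h3⟩ := T.unique x hx s hs f' hf' e' he' hfi hei
      (hdec.trans (mul_assoc _ _ _).symm) hR hL
    exact ⟨h1, h3, h2⟩

theorem e_mul_bar (x : S) : T.e x * T.bar x = x * T.star (T.bar x) := by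
  calc T.e x * T.bar x = T.e x * (T.bar x * (T.f x * T.star (T.bar x))) := by
        rw [T.f_mul_star, T.mul_star (T.bar_mem' x)]
    _ = T.e x * T.bar x * T.f x * T.star (T.bar x) := by simp only [mul_assoc]
    _ = x * T.star (T.bar x) := by rw [T.eq_mul]

theorem e_mul_self (x : S) : T.e x * x = x := by
  calc T.e x * x = T.e x * (T.e x * T.bar x * T.f x) := by rw [T.eq_mul]
    _ = T.e x * T.e x * T.bar x * T.f x := by simp only [mul_assoc]
    _ = x := by rw [T.e_mul_e, T.eq_mul]

theorem rstar_e (x : S) : RStarOn (mulOf S) univ x (T.e x) := by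
  have key (a b : S) : a * x = b * x ↔ a * T.e x = b * T.e x := by
    constructor
    · intro h
      have h1 : a * T.e x * T.bar x = b * T.e x * T.bar x := by
        rw [mul_assoc, mul_assoc, T.e_mul_bar, ← mul_assoc, ← mul_assoc, h]
      have h2 := ((T.plus_rstar _ (T.bar_mem' x)).mul_eq_iff _ _).1 h1
      rwa [mul_assoc, mul_assoc, T.e_mul_plus] at h2
    · intro h
      rw [← T.e_mul_self x, ← mul_assoc, ← mul_assoc, h]
  refine ⟨fun a _ b _ => key a b, fun a _ => ?_⟩
  have := key a (T.e x)
  rwa [T.e_mul_self, T.e_mul_e] at this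

end AdequateTransversalOn

end Semigroup

/-- The opposite semigroup structure on the same type. -/
abbrev oppositeSemigroup (S : Type*) [Semigroup S] : Semigroup S where
  mul a b := b * a
  mul_assoc a b c := (mul_assoc c b a).symm

section Semigroup

variable {S : Type*} [Semigroup S]

namespace AdequateTransversalOn

variable {S0 : Set S} (T : AdequateTransversalOn (mulOf S) univ S0)

theorem lstar_f (x : S) : LStarOn (mulOf S) univ x (T.f x) :=
  @rstar_e S (oppositeSemigroup S) S0 T.dual x

theorem mem_Lset_iff {x : S} : x ∈ T.Lset ↔ T.f x = T.star (T.bar x) := by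
  simp [Lset, (T.decomp_of_mem (T.bar_mem' x)).2.2]

theorem mem_Rset_iff {x : S} : x ∈ T.Rset ↔ T.e x = T.plus (T.bar x) := by
  simp [Rset, (T.decomp_of_mem (T.bar_mem' x)).2.1]

theorem subset_Lset : S0 ⊆ T.Lset := fun s hs => by
  obtain ⟨h1, -, h3⟩ := T.decomp_of_mem hs
  rw [mem_Lset_iff, h1, h3]

theorem mul_mem_Lset {s g : S} (hs : s ∈ S0) (hg1 : g * T.plus s = g)
    (hg2 : T.plus s * g = T.plus s) : g * s ∈ T.Lset := by
  obtain ⟨h1, -, h3⟩ := T.decomp_unique_left hs hg1 hg2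
  rw [mem_Lset_iff, h1, h3]

theorem mul_mem_Rset {s h : S} (hs : s ∈ S0) (hh1 : T.star s * h = h)
    (hh2 : h * T.star s = T.star s) : s * h ∈ T.Rset := by
  obtain ⟨h1, h2, -⟩ := T.decomp_unique_right hs hh1 hh2
  rw [mem_Rset_iff, h1, h2]

theorem eq_mul_of_mem_Lset {x : S} (hx : x ∈ T.Lset) : T.e x * T.bar x = x := by
  have h := T.eq_mul x
  rwa [T.mem_Lset_iff.1 hx, mul_assoc, T.mul_star (T.bar_mem' x)] at h

theorem eq_mul_of_mem_Rset {x : S} (hx : x ∈ T.Rset) : T.bar x * T.f x = x := by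
  have h := T.eq_mul x
  rwa [T.mem_Rset_iff.1 hx, T.plus_mul (T.bar_mem' x)] at h

/-- The idempotent `e_x` has trivial right part: its decomposition is `e_x x̄⁺`. -/
theorem decomp_e (x : S) : T.bar (T.e x) = T.plus (T.bar x) ∧ T.e (T.e x) = T.e x ∧
    T.f (T.e x) = T.plus (T.bar x) := by
  have hp := T.plus_mem _ (T.bar_mem' x)
  have hpp := T.plus_mul_plus (T.bar_mem' x)
  have hp1 := T.plus_eq_self hp hpp
  have := T.decomp_unique_left (g := T.e x) hp (by rw [hp1, T.e_mul_plus])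
    (by rw [hp1, T.plus_mul_e])
  rwa [T.e_mul_plus, T.star_eq_self hp hpp] at this

theorem e_mem_Lset (x : S) : T.e x ∈ T.Lset := by
  obtain ⟨h1, -, h3⟩ := T.decomp_e x
  rw [mem_Lset_iff, h1, h3, T.star_eq_self (T.plus_mem _ (T.bar_mem' x))
    (T.plus_mul_plus (T.bar_mem' x))]

theorem mul_plus_decomp {s w g : S} (hs : s ∈ S0) (hw : w ∈ S0) (hsw : T.plus s * w = w)
    (hg : T.plus s * g = T.plus s) :
    g * T.plus w * T.plus w = g * T.plus w ∧ T.plus w * (g * T.plus w) = T.plus w := by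
  have h1 : T.plus s * T.plus w = T.plus w := ((T.plus_rstar w hw).mul_eq_self_iff _).1 hsw
  have h2 : T.plus w * T.plus s = T.plus w :=
    (T.idem_comm _ (T.plus_mem w hw) _ (T.plus_mem s hs) (T.plus_idem w hw)
      (T.plus_idem s hs)).trans h1
  refine ⟨by rw [mul_assoc, T.plus_mul_plus hw], ?_⟩
  calc T.plus w * (g * T.plus w) = T.plus w * T.plus s * (g * T.plus w) := by rw [h2]
    _ = T.plus w * (T.plus s * g) * T.plus w := by simp only [mul_assoc]
    _ = T.plus w := by rw [hg, h2, T.plus_mul_plus hw]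

theorem star_mul_decomp {t w h : S} (ht : t ∈ S0) (hw : w ∈ S0) (hwt : w * T.star t = w)
    (hh : h * T.star t = T.star t) :
    T.star w * (T.star w * h) = T.star w * h ∧ T.star w * h * T.star w = T.star w :=
  @mul_plus_decomp S (oppositeSemigroup S) S0 T.dual t w h ht hw hwt hh

theorem mul_mid_mem (hq : QuasiIdealOn (mulOf S) univ S0) {s t : S} (hs : s ∈ S0) (ht : t ∈ S0)
    (a b : S) : s * a * (b * t) ∈ S0 := by
  have := hq s hs (a * b) (mem_univ _) t ht
  simpa only [mulOf, mul_assoc] using this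

/-- The decomposition of a product `x y`, whose middle part is `x̄ f_x e_y ȳ`. -/
theorem decomp_mul (hq : QuasiIdealOn (mulOf S) univ S0) {x y w : S}
    (h : w = T.bar x * T.f x * (T.e y * T.bar y)) :
    w ∈ S0 ∧ T.bar (x * y) = w ∧ T.e (x * y) = T.e x * T.plus w ∧
      T.f (x * y) = T.star w * T.f y := by
  have hs := T.bar_mem' x
  have ht := T.bar_mem' y
  have hw : w ∈ S0 := h ▸ mul_mid_mem hq hs ht _ _
  have hsw : T.plus (T.bar x) * w = w := by
    rw [h, ← mul_assoc, ← mul_assoc (T.plus _), T.plus_mul hs]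
  have hwt : w * T.star (T.bar y) = w := by
    rw [h, mul_assoc, mul_assoc (T.e y), T.mul_star ht]
  have hg := T.mul_plus_decomp hs hw hsw (T.plus_mul_e x)
  have hh := T.star_mul_decomp ht hw hwt (T.f_mul_star y)
  have hxy : T.e x * T.plus w * w * (T.star w * T.f y) = x * y := by
    calc T.e x * T.plus w * w * (T.star w * T.f y)
        = T.e x * (T.plus w * w * T.star w) * T.f y := by simp only [mul_assoc]
      _ = T.e x * w * T.f y := by rw [T.plus_mul hw, T.mul_star hw]
      _ = (T.e x * T.bar x * T.f x) * (T.e y * T.bar y * T.f y) := by rw [h]; simp only [mul_assoc]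
      _ = x * y := by rw [T.eq_mul, T.eq_mul]
  have := T.decomp_unique hw hg.1 hg.2 hh.1 hh.2
  rw [hxy] at this
  exact ⟨hw, this⟩

theorem closedOn_Lset (hq : QuasiIdealOn (mulOf S) univ S0) : ClosedOn (mulOf S) T.Lset := by
  intro x _ y hy
  obtain ⟨hw, h1, -, h3⟩ := T.decomp_mul hq (x := x) (y := y) rfl
  rw [mem_Lset_iff, mulOf, h1, h3, T.mem_Lset_iff.1 hy]
  refine ((T.star_lstar _ hw).mul_eq_self_iff _).1 ?_
  rw [mul_assoc, mul_assoc (T.e y), T.mul_star (T.bar_mem' y)]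

theorem e_eq_self_of_idem {u : S} (hu : u ∈ T.Lset) (huu : u * u = u) : T.e u = u := by
  have hs := T.bar_mem' u
  have hq := T.star_mem _ hs
  have hqq := T.star_mul_star hs
  have h1 : T.e u * T.bar u = u := T.eq_mul_of_mem_Lset hu
  have h2 : u * T.e u = T.e u := ((T.rstar_e u).mul_eq_self_iff u).1 huu
  have h3 : T.bar u * u = T.bar u := by
    calc T.bar u * u = T.plus (T.bar u) * T.e u * T.bar u * u := by
          rw [T.plus_mul_e, T.plus_mul hs]
      _ = T.plus (T.bar u) * (T.e u * T.bar u) * u := by simp only [mul_assoc]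
      _ = T.plus (T.bar u) * T.e u * T.bar u := by rw [h1, mul_assoc, huu, mul_assoc, h1]
      _ = T.bar u := by rw [T.plus_mul_e, T.plus_mul hs]
  have h4 : T.star (T.bar u) * u = T.star (T.bar u) :=
    ((T.star_lstar _ hs).mul_eq_self_iff u).1 h3
  have h5 : u * T.star (T.bar u) = u := by rw [← T.e_mul_bar, h1]
  have hp := T.plus_eq_self hq hqq
  have h6 := (T.decomp_unique_left (g := u) hq (by rw [hp, h5]) (by rw [hp, h4])).2.1
  rwa [h5] at h6

theorem plus_eq_of_mul_eq {s p a : S} (hs : s ∈ S0) (hp : p ∈ S0) (hpp : p * p = p)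
    (h1 : p * s = s) (h2 : s * a = p) : T.plus s = p := by
  have h3 : p * T.plus s = T.plus s := ((T.plus_rstar s hs).mul_eq_self_iff p).1 h1
  have h4 : T.plus s * p = p := by rw [← h2, ← mul_assoc, T.plus_mul hs]
  have h5 : p * T.plus s = T.plus s * p :=
    T.idem_comm p hp _ (T.plus_mem s hs) hpp (T.plus_idem s hs)
  rw [← h3, h5, h4]

theorem e_eq_e_of_mul_eq (hq : QuasiIdealOn (mulOf S) univ S0) {x y : S}
    (h1 : T.e x * T.e y = T.e y) (h2 : T.e y * T.e x = T.e x) : T.e x = T.e y := by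
  have hs := T.bar_mem' y
  have hp := T.plus_mem _ hs
  have hpp := T.plus_mul_plus hs
  have ht : T.plus (T.bar y) * T.e x ∈ S0 := by
    have := hq _ hp (T.e x) (mem_univ _) _ (T.plus_mem _ (T.bar_mem' x))
    rwa [mulOf_apply, mulOf_apply, mul_assoc, T.e_mul_plus] at this
  have hplus : T.plus (T.plus (T.bar y) * T.e x) = T.plus (T.bar y) :=
    T.plus_eq_of_mul_eq (a := T.e y) ht hp hpp (by rw [← mul_assoc, hpp])
      (by rw [mul_assoc, h1, T.plus_mul_e])
  have h3 := (T.decomp_unique_left (g := T.e y) ht (by rw [hplus, T.e_mul_plus])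
    (by rw [hplus, T.plus_mul_e])).2.1
  rwa [← mul_assoc, T.e_mul_plus, h2, (T.decomp_e x).2.1] at h3

theorem leftAdequateOn_Lset (hq : QuasiIdealOn (mulOf S) univ S0) :
    LeftAdequateOn (mulOf S) T.Lset := by
  refine ⟨fun x hx => ⟨⟨T.e x, T.e_mem_Lset x, T.e_mul_e x, (T.rstar_e x).mono (subset_univ _)⟩,
    ⟨T.f x, ?_, T.f_mul_f x, (T.lstar_f x).mono (subset_univ _)⟩⟩, ?_⟩
  · rw [T.mem_Lset_iff.1 hx]
    exact T.subset_Lset (T.star_mem _ (T.bar_mem' x))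
  · intro u hu v hv huu hvv h
    have h1 := T.e_eq_self_of_idem hu huu
    have h2 := T.e_eq_self_of_idem hv hvv
    rw [← h1, ← h2]
    apply T.e_eq_e_of_mul_eq hq
    · rw [h1, h2]
      exact (h.2 u hu).1 huu
    · rw [h1, h2]
      exact (h.2 v hv).2 hvv

/-- Restriction of an adequate transversal to a subset closed under `e` and `f`. -/
def restrict {V : Set S} (hV : S0 ⊆ V) (he : ∀ x ∈ V, T.e x ∈ V) (hf : ∀ x ∈ V, T.f x ∈ V) :
    AdequateTransversalOn (mulOf S) V S0 where
  sub := hV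
  mul_mem := T.mul_mem
  bar := T.bar
  e := T.e
  f := T.f
  plus := T.plus
  star := T.star
  plus_mem := T.plus_mem
  plus_idem := T.plus_idem
  plus_rstar s hs := (T.plus_rstar s hs).mono (subset_univ _)
  star_mem := T.star_mem
  star_idem := T.star_idem
  star_lstar s hs := (T.star_lstar s hs).mono (subset_univ _)
  idem_comm := T.idem_comm
  bar_mem x _ := T.bar_mem' x
  e_mem := he
  f_mem := hf
  e_idem x _ := T.e_mul_e x
  f_idem x _ := T.f_mul_f x
  decomp x _ := (T.eq_mul x).symm
  e_greenL x hx := ⟨Or.inr ⟨_, he x hx, T.e_mul_plus x⟩,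
    Or.inr ⟨_, hV (T.plus_mem _ (T.bar_mem' x)), T.plus_mul_e x⟩⟩
  f_greenR x hx := ⟨Or.inr ⟨_, hf x hx, T.star_mul_f x⟩,
    Or.inr ⟨_, hV (T.star_mem _ (T.bar_mem' x)), T.f_mul_star x⟩⟩
  unique x _ s hs g _ h _ hg hh hx hL hR := T.unique x (mem_univ _) s hs g (mem_univ _) h
    (mem_univ _) hg hh hx (hL.mono (subset_univ _)) (hR.mono (subset_univ _))

theorem nonempty_transversal_Lset : Nonempty (AdequateTransversalOn (mulOf S) T.Lset S0) :=
  ⟨T.restrict T.subset_Lset (fun x _ => T.e_mem_Lset x) fun x hx => by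
    rw [T.mem_Lset_iff.1 hx]
    exact T.subset_Lset (T.star_mem _ (T.bar_mem' x))⟩

theorem quasiIdealOn_dual (hq : QuasiIdealOn (mulOf S) univ S0) :
    QuasiIdealOn (fun a b : S => b * a) univ S0 := by
  intro s hs x hx t ht
  have := hq t ht x hx s hs
  rwa [mulOf, mulOf, mul_assoc] at this

theorem closedOn_Rset (hq : QuasiIdealOn (mulOf S) univ S0) : ClosedOn (mulOf S) T.Rset :=
  fun x hx y hy => @closedOn_Lset S (oppositeSemigroup S) S0 T.dual (quasiIdealOn_dual hq) y hy x hx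

theorem rightAdequateOn_Rset (hq : QuasiIdealOn (mulOf S) univ S0) :
    RightAdequateOn (mulOf S) T.Rset := by
  have h := @leftAdequateOn_Lset S (oppositeSemigroup S) S0 T.dual (quasiIdealOn_dual hq)
  exact ⟨fun x hx => (h.1 x hx).symm, h.2⟩

theorem f_mem_Rset (x : S) : T.f x ∈ T.Rset :=
  @e_mem_Lset S (oppositeSemigroup S) S0 T.dual x

theorem subset_Rset : S0 ⊆ T.Rset :=
  @subset_Lset S (oppositeSemigroup S) S0 T.dual

theorem nonempty_transversal_Rset : Nonempty (AdequateTransversalOn (mulOf S) T.Rset S0) :=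
  ⟨T.restrict T.subset_Rset (fun x hx => by
    rw [T.mem_Rset_iff.1 hx]
    exact T.subset_Rset (T.plus_mem _ (T.bar_mem' x))) fun x _ => T.f_mem_Rset x⟩

theorem decomp_phiMap_fst (x : S) :
    T.bar (T.e x * T.bar x) = T.bar x ∧ T.e (T.e x * T.bar x) = T.e x ∧
      T.f (T.e x * T.bar x) = T.star (T.bar x) :=
  T.decomp_unique_left (T.bar_mem' x) (T.e_mul_plus x) (T.plus_mul_e x)

theorem decomp_phiMap_snd (x : S) :
    T.bar (T.bar x * T.f x) = T.bar x ∧ T.e (T.bar x * T.f x) = T.plus (T.bar x) ∧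
      T.f (T.bar x * T.f x) = T.f x :=
  T.decomp_unique_right (T.bar_mem' x) (T.star_mul_f x) (T.f_mul_star x)

/-- The inverse of `phiMap`. -/
def phiInv (p : S × S) : S := T.e p.1 * T.bar p.1 * T.f p.2

theorem leftInverse_phiInv : Function.LeftInverse T.phiInv (phiMap T) := fun x => by
  simp only [phiInv, phiMap, mulOf_apply, (T.decomp_phiMap_fst x).1, (T.decomp_phiMap_fst x).2.1,
    (T.decomp_phiMap_snd x).2.2, T.eq_mul]

theorem phiMap_phiInv {p : S × S} (hp : p ∈ spSet T) : phiMap T (T.phiInv p) = p := by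
  obtain ⟨h1, h2, h3⟩ := hp
  obtain ⟨k1, k2, k3⟩ := T.decomp_unique (T.bar_mem' p.1) (T.e_mul_plus p.1) (T.plus_mul_e p.1)
    (h := T.f p.2) (by rw [h3, T.star_mul_f]) (by rw [h3, T.f_mul_star])
  rw [phiInv, phiMap, k1, k2, k3, mulOf_apply, mulOf_apply, T.eq_mul_of_mem_Lset h1, h3, T.eq_mul_of_mem_Rset h2]

theorem bijOn_phiMap : BijOn (phiMap T) univ (spSet T) := by
  refine ⟨fun x _ => ⟨?_, ?_, ?_⟩, T.leftInverse_phiInv.injective.injOn,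
    fun p hp => ⟨T.phiInv p, mem_univ _, T.phiMap_phiInv hp⟩⟩
  · exact T.mul_mem_Lset (T.bar_mem' x) (T.e_mul_plus x) (T.plus_mul_e x)
  · exact T.mul_mem_Rset (T.bar_mem' x) (T.star_mul_f x) (T.f_mul_star x)
  · exact (T.decomp_phiMap_fst x).1.trans (T.decomp_phiMap_snd x).1.symm

theorem phiMap_mul (hq : QuasiIdealOn (mulOf S) univ S0) (x y : S) :
    phiMap T (x * y) = spMul T (phiMap T x) (phiMap T y) := by
  obtain ⟨hw, h1, h2, h3⟩ := T.decomp_mul hq (x := x) (y := y) rfl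
  simp only [phiMap, spMul, (T.decomp_phiMap_fst x).2.1, (T.decomp_phiMap_snd y).2.2, h1, h2, h3,
    mulOf]
  rw [mul_assoc (T.e x), T.plus_mul hw, ← mul_assoc _ (T.star _) (T.f y), T.mul_star hw]

theorem phiMap_of_mem {s : S} (hs : s ∈ S0) : phiMap T s = (s, s) := by
  obtain ⟨h1, h2, h3⟩ := T.decomp_of_mem hs
  rw [phiMap, h1, h2, h3, mulOf_apply, mulOf_apply, T.plus_mul hs, T.mul_star hs]

theorem image_phiMap : phiMap T '' S0 = diagSet S0 := by
  ext p
  constructor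
  · rintro ⟨s, hs, rfl⟩
    exact ⟨s, hs, T.phiMap_of_mem hs⟩
  · rintro ⟨s, hs, rfl⟩
    exact ⟨s, hs, T.phiMap_of_mem hs⟩

end AdequateTransversalOn

end Semigroup

section Transport

variable {α β : Type*} {mulA : α → α → α} {mulB : β → β → β} {V : Set β} {θ : α → β}

theorem SemigroupOn.of_bijOn (h : SemigroupOn mulA univ) (hθ : BijOn θ univ V)
    (hom : ∀ a b, θ (mulA a b) = mulB (θ a) (θ b)) : SemigroupOn mulB V := by
  have hmem (a : α) : θ a ∈ V := hθ.mapsTo (mem_univ a)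
  constructor
  · intro x hx y hy
    obtain ⟨a, -, rfl⟩ := hθ.surjOn hx
    obtain ⟨b, -, rfl⟩ := hθ.surjOn hy
    exact hom a b ▸ hmem _
  · intro x hx y hy z hz
    obtain ⟨a, -, rfl⟩ := hθ.surjOn hx
    obtain ⟨b, -, rfl⟩ := hθ.surjOn hy
    obtain ⟨c, -, rfl⟩ := hθ.surjOn hz
    simp only [← hom, h.2 a (mem_univ _) b (mem_univ _) c (mem_univ _)]

theorem QuasiIdealOn.image {S0 : Set α} (h : QuasiIdealOn mulA univ S0) (hθ : BijOn θ univ V)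
    (hom : ∀ a b, θ (mulA a b) = mulB (θ a) (θ b)) : QuasiIdealOn mulB V (θ '' S0) := by
  rintro _ ⟨s, hs, rfl⟩ x hx _ ⟨t, ht, rfl⟩
  obtain ⟨a, -, rfl⟩ := hθ.surjOn hx
  exact ⟨_, h s hs a (mem_univ _) t ht, by simp only [hom]⟩

theorem idem_map_iff (hinj : Function.Injective θ)
    (hom : ∀ a b, θ (mulA a b) = mulB (θ a) (θ b)) {a : α} : Idem mulB (θ a) ↔ Idem mulA a := by
  rw [Idem, Idem, ← hom, hinj.eq_iff]

theorem rStarOn_map_iff (hθ : BijOn θ univ V) (hom : ∀ a b, θ (mulA a b) = mulB (θ a) (θ b))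
    {a b : α} : RStarOn mulB V (θ a) (θ b) ↔ RStarOn mulA univ a b := by
  have hinj : Function.Injective θ := injOn_univ.1 hθ.injOn
  simp only [RStarOn, ← hθ.image_eq, forall_mem_image, ← hom, hinj.eq_iff]

theorem lStarOn_map_iff (hθ : BijOn θ univ V) (hom : ∀ a b, θ (mulA a b) = mulB (θ a) (θ b))
    {a b : α} : LStarOn mulB V (θ a) (θ b) ↔ LStarOn mulA univ a b := by
  have hinj : Function.Injective θ := injOn_univ.1 hθ.injOn
  simp only [LStarOn, ← hθ.image_eq, forall_mem_image, ← hom, hinj.eq_iff]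

theorem greenLOn_map_iff (hθ : BijOn θ univ V) (hom : ∀ a b, θ (mulA a b) = mulB (θ a) (θ b))
    {a b : α} : GreenLOn mulB V (θ a) (θ b) ↔ GreenLOn mulA univ a b := by
  have hinj : Function.Injective θ := injOn_univ.1 hθ.injOn
  simp only [GreenLOn, ← hθ.image_eq, exists_mem_image, ← hom, hinj.eq_iff]

theorem greenROn_map_iff (hθ : BijOn θ univ V) (hom : ∀ a b, θ (mulA a b) = mulB (θ a) (θ b))
    {a b : α} : GreenROn mulB V (θ a) (θ b) ↔ GreenROn mulA univ a b := by
  have hinj : Function.Injective θ := injOn_univ.1 hθ.injOn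
  simp only [GreenROn, ← hθ.image_eq, exists_mem_image, ← hom, hinj.eq_iff]

/-- Transport of an adequate transversal along an isomorphism `θ` with inverse `ψ`. -/
def AdequateTransversalOn.map {S0 : Set α} (T : AdequateTransversalOn mulA univ S0)
    (hθ : BijOn θ univ V) (hom : ∀ a b, θ (mulA a b) = mulB (θ a) (θ b)) {ψ : β → α}
    (hψ : Function.LeftInverse ψ θ) : AdequateTransversalOn mulB V (θ '' S0) where
  sub := (image_mono (subset_univ _)).trans hθ.image_eq.subset
  mul_mem := by
    rintro _ ⟨a, ha, rfl⟩ _ ⟨b, hb, rfl⟩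
    exact ⟨_, T.mul_mem a ha b hb, hom a b⟩
  bar x := θ (T.bar (ψ x))
  e x := θ (T.e (ψ x))
  f x := θ (T.f (ψ x))
  plus x := θ (T.plus (ψ x))
  star x := θ (T.star (ψ x))
  plus_mem := by
    rintro _ ⟨a, ha, rfl⟩
    rw [hψ]
    exact mem_image_of_mem _ (T.plus_mem a ha)
  plus_idem := by
    rintro _ ⟨a, ha, rfl⟩
    rw [hψ, idem_map_iff hψ.injective hom]
    exact T.plus_idem a ha
  plus_rstar := by
    rintro _ ⟨a, ha, rfl⟩
    rw [hψ, rStarOn_map_iff hθ hom]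
    exact T.plus_rstar a ha
  star_mem := by
    rintro _ ⟨a, ha, rfl⟩
    rw [hψ]
    exact mem_image_of_mem _ (T.star_mem a ha)
  star_idem := by
    rintro _ ⟨a, ha, rfl⟩
    rw [hψ, idem_map_iff hψ.injective hom]
    exact T.star_idem a ha
  star_lstar := by
    rintro _ ⟨a, ha, rfl⟩
    rw [hψ, lStarOn_map_iff hθ hom]
    exact T.star_lstar a ha
  idem_comm := by
    rintro _ ⟨a, ha, rfl⟩ _ ⟨b, hb, rfl⟩ haa hbb
    rw [idem_map_iff hψ.injective hom] at haa hbb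
    rw [← hom, ← hom, T.idem_comm a ha b hb haa hbb]
  bar_mem _ _ := mem_image_of_mem _ (T.bar_mem _ (mem_univ _))
  e_mem _ _ := hθ.mapsTo (mem_univ _)
  f_mem _ _ := hθ.mapsTo (mem_univ _)
  e_idem _ _ := (idem_map_iff hψ.injective hom).2 (T.e_idem _ (mem_univ _))
  f_idem _ _ := (idem_map_iff hψ.injective hom).2 (T.f_idem _ (mem_univ _))
  decomp x hx := by
    obtain ⟨a, -, rfl⟩ := hθ.surjOn hx
    rw [hψ, ← hom, ← hom, ← T.decomp a (mem_univ _)]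
  e_greenL x _ := by
    rw [hψ, greenLOn_map_iff hθ hom]
    exact T.e_greenL _ (mem_univ _)
  f_greenR x _ := by
    rw [hψ, greenROn_map_iff hθ hom]
    exact T.f_greenR _ (mem_univ _)
  unique := by
    rintro x hx _ ⟨s, hs, rfl⟩ g hg h hh hgg hhh hdec hL hR
    obtain ⟨a, -, rfl⟩ := hθ.surjOn hx
    obtain ⟨g, -, rfl⟩ := hθ.surjOn hg
    obtain ⟨h, -, rfl⟩ := hθ.surjOn hh
    rw [hψ, greenLOn_map_iff hθ hom] at hL
    rw [hψ, greenROn_map_iff hθ hom] at hR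
    rw [idem_map_iff hψ.injective hom] at hgg hhh
    rw [← hom, ← hom, hψ.injective.eq_iff] at hdec
    obtain ⟨h1, h2, h3⟩ :=
      T.unique a (mem_univ _) s hs g (mem_univ _) h (mem_univ _) hgg hhh hdec hL hR
    rw [hψ, h1, h2, h3]
    exact ⟨rfl, rfl, rfl⟩

end Transport

end Paper

open Paper in
/-- Let `S⁰` be a quasi-ideal adequate transversal of an abundant
semigroup `S`.  Then (taking `L = {x : f_x = f_{x̄}}`, `R = {x : e_x = e_{x̄}}`)
there exist a left adequate semigroup `L` and a right adequate semigroup `R`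
having `S⁰` as a common quasi-ideal adequate transversal, such that `S` is
isomorphic (via `φ`) to the spined product `T = L |×| R` with
`(x,a)(y,b) = (e_x a y, a y f_b)`, and `T⁰ = {(s,s) : s ∈ S⁰}` is a quasi-ideal
adequate transversal of `T` isomorphic to `S⁰`. -/
theorem stmt7 {S : Type*} [Semigroup S] (S0 : Set S)
    (hS : AbundantOn (mulOf S) Set.univ)
    (T : AdequateTransversalOn (mulOf S) Set.univ S0)
    (hq : QuasiIdealOn (mulOf S) Set.univ S0) :
    ClosedOn (mulOf S) T.Lset ∧ ClosedOn (mulOf S) T.Rset ∧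
    LeftAdequateOn (mulOf S) T.Lset ∧ RightAdequateOn (mulOf S) T.Rset ∧
    Nonempty (AdequateTransversalOn (mulOf S) T.Lset S0) ∧
    Nonempty (AdequateTransversalOn (mulOf S) T.Rset S0) ∧
    QuasiIdealOn (mulOf S) T.Lset S0 ∧ QuasiIdealOn (mulOf S) T.Rset S0 ∧
    SemigroupOn (spMul T) (spSet T) ∧
    Set.BijOn (phiMap T) Set.univ (spSet T) ∧
    (∀ x y : S, phiMap T (x * y) = spMul T (phiMap T x) (phiMap T y)) ∧
    Nonempty (AdequateTransversalOn (spMul T) (spSet T) (diagSet S0)) ∧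
    QuasiIdealOn (spMul T) (spSet T) (diagSet S0) ∧
    IsoOn (mulOf S) (spMul T) S0 (diagSet S0) := by
  have hhom := T.phiMap_mul hq
  refine ⟨T.closedOn_Lset hq, T.closedOn_Rset hq, T.leftAdequateOn_Lset hq,
    T.rightAdequateOn_Rset hq, T.nonempty_transversal_Lset, T.nonempty_transversal_Rset,
    hq.mono (Set.subset_univ _), hq.mono (Set.subset_univ _),
    SemigroupOn.of_bijOn (mulA := mulOf S) ?_ T.bijOn_phiMap hhom, T.bijOn_phiMap, hhom, ?_, ?_,
    phiMap T, ?_, fun a _ b _ => hhom a b⟩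
  · exact ⟨fun _ _ _ _ => Set.mem_univ _, fun a _ b _ c _ => mul_assoc a b c⟩
  · rw [← T.image_phiMap]
    exact ⟨T.map T.bijOn_phiMap hhom T.leftInverse_phiInv⟩
  · rw [← T.image_phiMap]
    exact hq.image T.bijOn_phiMap hhom
  · rw [← T.image_phiMap]
    exact T.leftInverse_phiInv.injective.injOn.bijOn_image
end

section
/- Let S⁰ be an adequate semigroup with semilattice of idempotents E⁰, L a left adequate semigroup and R a right adequate semigroup such that S⁰ is a quasi-ideal adequate transversal of both L and R, and let ∗ : R × L → S⁰ satisfy conditions (1) and (2). Then T = {(x,a) ∈ L × R : x̄ = ā} with multiplication (x,a)(y,b) = (e_x(a∗y), (a∗y)f_b) is an abundant semigroup, and T⁰ = {(s,s) : s ∈ S⁰} is a quasi-ideal adequate transversal of T isomorphic to S⁰. -/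
namespace Paper

section SpinedProduct

variable {L R G : Type*} [Semigroup L] [Semigroup R] [Semigroup G]

/-- The data `x = e_x x̄` of an adequate transversal `j : G → L` of a left adequate semigroup. -/
structure IsLeftTransversal (j : G → L) (bar : L → G) (e : L → L) (plus : G → G) : Prop where
  inj : Function.Injective j
  map_mul (s t : G) : j (s * t) = j s * j t
  plus_comm (s t : G) : plus s * plus t = plus t * plus s
  plus_mul_plus (s : G) : plus s * plus s = plus s
  plus_mul_self (s : G) : plus s * s = s
  plus_plus (s : G) : plus (plus s) = plus s
  rstar (s : G) (x y : L) : x * j s = y * j s ↔ x * j (plus s) = y * j (plus s)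
  decomp (x : L) : e x * j (bar x) = x
  e_mul_plus (x : L) : e x * j (plus (bar x)) = e x
  plus_mul_e (x : L) : j (plus (bar x)) * e x = j (plus (bar x))
  unique (s : G) (u : L) : u * j (plus s) = u → j (plus s) * u = j (plus s) →
    bar (u * j s) = s ∧ e (u * j s) = u

/-- The data `a = ā f_a` of an adequate transversal `j : G → R` of a right adequate semigroup. -/
structure IsRightTransversal (j : G → R) (bar : R → G) (f : R → R) (star : G → G) : Prop where
  inj : Function.Injective j
  map_mul (s t : G) : j (s * t) = j s * j t
  star_comm (s t : G) : star s * star t = star t * star s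
  star_mul_star (s : G) : star s * star s = star s
  self_mul_star (s : G) : s * star s = s
  star_star (s : G) : star (star s) = star s
  lstar (s : G) (x y : R) : j s * x = j s * y ↔ j (star s) * x = j (star s) * y
  decomp (a : R) : j (bar a) * f a = a
  star_mul_f (a : R) : j (star (bar a)) * f a = f a
  f_mul_star (a : R) : f a * j (star (bar a)) = j (star (bar a))
  unique (s : G) (w : R) : j (star s) * w = w → w * j (star s) = j (star s) →
    bar (j s * w) = s ∧ f (j s * w) = w

namespace IsLeftTransversal

variable {j : G → L} {bar : L → G} {e : L → L} {plus : G → G}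

theorem map_eq (h : IsLeftTransversal j bar e plus) (s : G) :
    bar (j s) = s ∧ e (j s) = j (plus s) := by
  have := h.unique s (j (plus s)) (by rw [← h.map_mul, h.plus_mul_plus])
    (by rw [← h.map_mul, h.plus_mul_plus])
  rwa [← h.map_mul, h.plus_mul_self] at this

theorem eq_of_plus (h : IsLeftTransversal j bar e plus) {s : G} {u : L}
    (h₁ : u * j (plus s) = u) (h₂ : j (plus s) * u = j (plus s)) :
    bar u = plus s ∧ e u = u := by
  have := h.unique (plus s) u (by rwa [h.plus_plus]) (by rwa [h.plus_plus])
  rwa [h₁] at this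

theorem e_eq (h : IsLeftTransversal j bar e plus) (x : L) :
    bar (e x) = plus (bar x) ∧ e (e x) = e x :=
  h.eq_of_plus (h.e_mul_plus x) (h.plus_mul_e x)

theorem e_mul_eq (h : IsLeftTransversal j bar e plus) {x : L} {g : G}
    (hg : plus (bar x) * g = g) :
    bar (e x * j g) = g ∧ e (e x * j g) = e x * j (plus g) := by
  have hp : plus g * plus (bar x) = plus g := by
    rw [h.plus_comm]
    have := (h.rstar g (j (plus (bar x))) (j (plus g))).1
      (by rw [← h.map_mul, ← h.map_mul, hg, h.plus_mul_self])
    rw [← h.map_mul, ← h.map_mul, h.plus_mul_plus] at this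
    exact h.inj this
  have key := h.unique g (e x * j (plus g))
    (by rw [mul_assoc, ← h.map_mul, h.plus_mul_plus])
    (by rw [← hp, h.map_mul, mul_assoc, ← mul_assoc _ (e x), h.plus_mul_e, ← mul_assoc,
      ← mul_assoc, ← h.map_mul, ← h.map_mul, ← h.map_mul, hp, h.plus_mul_plus, hp])
  rwa [mul_assoc, ← h.map_mul, h.plus_mul_self] at key

end IsLeftTransversal

namespace IsRightTransversal

variable {j : G → R} {bar : R → G} {f : R → R} {star : G → G}

theorem map_eq (h : IsRightTransversal j bar f star) (s : G) :
    bar (j s) = s ∧ f (j s) = j (star s) := by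
  have := h.unique s (j (star s)) (by rw [← h.map_mul, h.star_mul_star])
    (by rw [← h.map_mul, h.star_mul_star])
  rwa [← h.map_mul, h.self_mul_star] at this

theorem eq_of_star (h : IsRightTransversal j bar f star) {s : G} {w : R}
    (h₁ : j (star s) * w = w) (h₂ : w * j (star s) = j (star s)) :
    bar w = star s ∧ f w = w := by
  have := h.unique (star s) w (by rwa [h.star_star]) (by rwa [h.star_star])
  rwa [h₁] at this

theorem f_eq (h : IsRightTransversal j bar f star) (a : R) :
    bar (f a) = star (bar a) ∧ f (f a) = f a :=
  h.eq_of_star (h.star_mul_f a) (h.f_mul_star a)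

theorem mul_f_eq (h : IsRightTransversal j bar f star) {a : R} {g : G}
    (hg : g * star (bar a) = g) :
    bar (j g * f a) = g ∧ f (j g * f a) = j (star g) * f a := by
  have hp : star (bar a) * star g = star g := by
    rw [h.star_comm]
    have := (h.lstar g (j (star (bar a))) (j (star g))).1
      (by rw [← h.map_mul, ← h.map_mul, hg, h.self_mul_star])
    rw [← h.map_mul, ← h.map_mul, h.star_mul_star] at this
    exact h.inj this
  have key := h.unique g (j (star g) * f a)
    (by rw [← mul_assoc, ← h.map_mul, h.star_mul_star])
    (by
      rw [← hp, h.map_mul, mul_assoc, ← mul_assoc (f a), h.f_mul_star]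
      simp only [← h.map_mul, hp, h.star_mul_star])
  rwa [← mul_assoc, ← h.map_mul, h.self_mul_star] at key

end IsRightTransversal

/-- An action `st : R × L → G` of transversals which makes the spined product associative. -/
structure IsSpinedSystem (jL : G → L) (jR : G → R) (barL : L → G) (barR : R → G)
    (e : L → L) (f : R → R) (plus star : G → G) (st : R → L → G) : Prop where
  left : IsLeftTransversal jL barL e plus
  right : IsRightTransversal jR barR f star
  assoc (y z : L) (a b : R) : barL y = barR b →
    st (jR (st a y) * f b) z = st a (e y * jL (st b z))
  map_st (s : G) (x : L) : jL (st (jR s) x) = jL s * x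
  st_map (a : R) (s : G) : jR (st a (jL s)) = a * jR s

/-- The multiplication `(x,a)(y,b) = (e_x(a∗y), (a∗y)f_b)`. -/
def spinedMul (jL : G → L) (jR : G → R) (e : L → L) (f : R → R) (st : R → L → G)
    (p q : L × R) : L × R :=
  (e p.1 * jL (st p.2 q.1), jR (st p.2 q.1) * f q.2)

/-- The pairs `(x,a)` with `x̄ = ā`. -/
def spinedSet (barL : L → G) (barR : R → G) : Set (L × R) := {p | barL p.1 = barR p.2}

namespace IsSpinedSystem

variable {jL : G → L} {jR : G → R} {barL : L → G} {barR : R → G} {e : L → L} {f : R → R}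
  {plus star : G → G} {st : R → L → G}

local notation "T" => spinedSet barL barR
local notation "μ" => spinedMul jL jR e f st

theorem st_map_map (h : IsSpinedSystem jL jR barL barR e f plus star st) (s t : G) :
    st (jR s) (jL t) = s * t :=
  h.left.inj (by rw [h.map_st, h.left.map_mul])

theorem plus_mul_st (h : IsSpinedSystem jL jR barL barR e f plus star st) (b : R) (z : L) :
    plus (barR b) * st b z = st b z := by
  have := h.assoc (jL (barR b)) z (jR (plus (barR b))) b (h.left.map_eq _).1
  rw [h.st_map_map, h.left.plus_mul_self, h.right.decomp, (h.left.map_eq _).2,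
    ← h.left.map_mul, h.st_map_map, ← mul_assoc, h.left.plus_mul_plus] at this
  exact this.symm

theorem st_mul_star (h : IsSpinedSystem jL jR barL barR e f plus star st) (a : R) (y : L) :
    st a y * star (barL y) = st a y := by
  have := h.assoc y (jL (star (barL y))) a (jR (barL y)) (h.right.map_eq _).1.symm
  rwa [h.st_map_map, h.right.self_mul_star, h.left.decomp, (h.right.map_eq _).2,
    ← h.right.map_mul, h.st_map_map, mul_assoc, h.right.star_mul_star] at this

theorem st_e_mul_bar (h : IsSpinedSystem jL jR barL barR e f plus star st) (a : R) (x : L) :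
    st a (e x) * barL x = st a x := by
  have := h.assoc (e x) (jL (barL x)) a (jR (plus (barL x)))
    (by rw [(h.left.e_eq x).1, (h.right.map_eq _).1])
  rwa [(h.right.map_eq _).2, ← (h.left.e_eq x).1, ← h.right.map_mul, h.st_mul_star,
    (h.left.e_eq x).1, h.st_map_map, h.st_map_map, h.left.plus_mul_self, (h.left.e_eq x).2,
    h.left.decomp] at this

theorem bar_mul_st_f (h : IsSpinedSystem jL jR barL barR e f plus star st) (a : R) (z : L) :
    barR a * st (f a) z = st a z := by
  have := h.assoc (jL (star (barR a))) z (jR (barR a)) (f a)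
    (by rw [(h.right.f_eq a).1, (h.left.map_eq _).1])
  rw [(h.left.map_eq _).2, ← (h.right.f_eq a).1, ← h.left.map_mul, h.plus_mul_st,
    (h.right.f_eq a).1, h.st_map_map, h.st_map_map, h.right.self_mul_star, (h.right.f_eq a).2,
    h.right.decomp] at this
  exact this.symm

theorem left_mul_eq (h : IsSpinedSystem jL jR barL barR e f plus star st) {p : L × R}
    (hp : p ∈ T) (q : L × R) :
    barL (μ p q).1 = st p.2 q.1 ∧ e (μ p q).1 = e p.1 * jL (plus (st p.2 q.1)) :=
  h.left.e_mul_eq (by rw [show barL p.1 = barR p.2 from hp, h.plus_mul_st])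

theorem right_mul_eq (h : IsSpinedSystem jL jR barL barR e f plus star st) (p : L × R)
    {q : L × R} (hq : q ∈ T) :
    barR (μ p q).2 = st p.2 q.1 ∧ f (μ p q).2 = jR (star (st p.2 q.1)) * f q.2 :=
  h.right.mul_f_eq (by rw [← show barL q.1 = barR q.2 from hq, h.st_mul_star])

theorem mul_mem (h : IsSpinedSystem jL jR barL barR e f plus star st) {p q : L × R}
    (hp : p ∈ T) (hq : q ∈ T) : μ p q ∈ T :=
  (h.left_mul_eq hp q).1.trans (h.right_mul_eq p hq).1.symm

theorem semigroupOn (h : IsSpinedSystem jL jR barL barR e f plus star st) :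
    SemigroupOn μ T := by
  refine ⟨fun p hp q hq => h.mul_mem hp hq, fun p hp q hq r hr => ?_⟩
  have hg : st (μ p q).2 r.1 = st p.2 (μ q r).1 := h.assoc _ _ _ _ hq
  have hl : plus (st p.2 q.1) * st (μ p q).2 r.1 = st (μ p q).2 r.1 := by
    rw [← (h.right_mul_eq p hq).1, h.plus_mul_st]
  have hr' : st p.2 (μ q r).1 * star (st q.2 r.1) = st p.2 (μ q r).1 := by
    rw [← (h.left_mul_eq hq r).1, h.st_mul_star]
  ext
  · change e (μ p q).1 * jL (st (μ p q).2 r.1) = e p.1 * jL (st p.2 (μ q r).1)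
    rw [(h.left_mul_eq hp q).2, mul_assoc, ← h.left.map_mul, hl, hg]
  · change jR (st (μ p q).2 r.1) * f r.2 = jR (st p.2 (μ q r).1) * f (μ q r).2
    rw [(h.right_mul_eq q hr).2, ← mul_assoc, ← h.right.map_mul, hr', hg]

theorem e_mem (h : IsSpinedSystem jL jR barL barR e f plus star st) (x : L) :
    (e x, jR (plus (barL x))) ∈ T :=
  (h.left.e_eq x).1.trans (h.right.map_eq _).1.symm

theorem f_mem (h : IsSpinedSystem jL jR barL barR e f plus star st) (a : R) :
    (jL (star (barR a)), f a) ∈ T :=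
  (h.left.map_eq _).1.trans (h.right.f_eq a).1.symm

theorem map_mem (h : IsSpinedSystem jL jR barL barR e f plus star st) (s : G) :
    (jL s, jR s) ∈ T :=
  (h.left.map_eq s).1.trans (h.right.map_eq s).1.symm

theorem map_mul_map (h : IsSpinedSystem jL jR barL barR e f plus star st) (s t : G) :
    μ (jL s, jR s) (jL t, jR t) = (jL (s * t), jR (s * t)) := by
  have hl := h.plus_mul_st (jR s) (jL t)
  have hr := h.st_mul_star (jR s) (jL t)
  rw [(h.right.map_eq s).1, h.st_map_map] at hl
  rw [(h.left.map_eq t).1, h.st_map_map] at hr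
  simp only [spinedMul, h.st_map_map]
  rw [(h.left.map_eq s).2, (h.right.map_eq t).2, ← h.left.map_mul, ← h.right.map_mul, hl, hr]

theorem rstarOn (h : IsSpinedSystem jL jR barL barR e f plus star st) {r : L × R}
    (hr : r ∈ T) : RStarOn μ T r (e r.1, jR (plus (barL r.1))) := by
  have hE := h.e_mem r.1
  have eq_iff : ∀ {p q r : L × R}, p ∈ T → q ∈ T →
      (μ p r = μ q r ↔ (μ p r).1 = (μ q r).1) := by
    refine fun {p q r} hp hq => ⟨congrArg _, fun h₁ => Prod.ext h₁ ?_⟩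
    have h₂ := congrArg barL h₁
    rw [(h.left_mul_eq hp r).1, (h.left_mul_eq hq r).1] at h₂
    change jR (st p.2 r.1) * f r.2 = jR (st q.2 r.1) * f r.2
    rw [h₂]
  have eq_self_iff : ∀ {p r : L × R}, p ∈ T → r ∈ T → (μ p r = r ↔ (μ p r).1 = r.1) := by
    refine fun {p r} hp hr => ⟨congrArg _, fun h₁ => Prod.ext h₁ ?_⟩
    have h₂ := congrArg barL h₁
    rw [(h.left_mul_eq hp r).1, show barL r.1 = barR r.2 from hr] at h₂
    change jR (st p.2 r.1) * f r.2 = r.2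
    rw [h₂, h.right.decomp]
  have fst_mul : ∀ p : L × R,
      (μ p r).1 = e p.1 * jL (st p.2 (e r.1)) * jL (barL r.1) := fun p => by
    rw [mul_assoc, ← h.left.map_mul, h.st_e_mul_bar, spinedMul]
  have fst_mul_e : ∀ p : L × R, (μ p (e r.1, jR (plus (barL r.1)))).1 =
      e p.1 * jL (st p.2 (e r.1)) * jL (plus (barL r.1)) := fun p => by
    have := h.st_e_mul_bar p.2 (e r.1)
    rw [(h.left.e_eq _).2, (h.left.e_eq _).1] at this
    rw [mul_assoc, ← h.left.map_mul, this, spinedMul]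
  refine ⟨fun p hp q hq => ?_, fun p hp => ?_⟩
  · rw [eq_iff hp hq, eq_iff hp hq, fst_mul, fst_mul, fst_mul_e, fst_mul_e, h.left.rstar]
  · rw [eq_self_iff hp hr, eq_self_iff hp hE, fst_mul, fst_mul_e]
    conv_lhs => rhs; rw [← h.left.decomp r.1]
    rw [h.left.rstar, h.left.e_mul_plus]

theorem lstarOn (h : IsSpinedSystem jL jR barL barR e f plus star st) {r : L × R}
    (hr : r ∈ T) : LStarOn μ T r (jL (star (barR r.2)), f r.2) := by
  have hF := h.f_mem r.2
  have eq_iff : ∀ {p q r : L × R}, p ∈ T → q ∈ T →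
      (μ r p = μ r q ↔ (μ r p).2 = (μ r q).2) := by
    refine fun {p q r} hp hq => ⟨congrArg _, fun h₁ => Prod.ext ?_ h₁⟩
    have h₂ := congrArg barR h₁
    rw [(h.right_mul_eq r hp).1, (h.right_mul_eq r hq).1] at h₂
    change e r.1 * jL (st r.2 p.1) = e r.1 * jL (st r.2 q.1)
    rw [h₂]
  have eq_self_iff : ∀ {p r : L × R}, p ∈ T → r ∈ T → (μ r p = r ↔ (μ r p).2 = r.2) := by
    refine fun {p r} hp hr => ⟨congrArg _, fun h₁ => Prod.ext ?_ h₁⟩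
    have h₂ := congrArg barR h₁
    rw [(h.right_mul_eq r hp).1, ← show barL r.1 = barR r.2 from hr] at h₂
    change e r.1 * jL (st r.2 p.1) = r.1
    rw [h₂, h.left.decomp]
  have snd_mul : ∀ p : L × R,
      (μ r p).2 = jR (barR r.2) * (jR (st (f r.2) p.1) * f p.2) := fun p => by
    rw [← mul_assoc, ← h.right.map_mul, h.bar_mul_st_f, spinedMul]
  have snd_f_mul : ∀ p : L × R, (μ (jL (star (barR r.2)), f r.2) p).2 =
      jR (star (barR r.2)) * (jR (st (f r.2) p.1) * f p.2) := fun p => by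
    have := h.bar_mul_st_f (f r.2) p.1
    rw [(h.right.f_eq _).2, (h.right.f_eq _).1] at this
    rw [← mul_assoc, ← h.right.map_mul, this, spinedMul]
  refine ⟨fun p hp q hq => ?_, fun p hp => ?_⟩
  · rw [eq_iff hp hq, eq_iff hp hq, snd_mul, snd_mul, snd_f_mul, snd_f_mul, h.right.lstar]
  · rw [eq_self_iff hp hr, eq_self_iff hp hF, snd_mul, snd_f_mul]
    conv_lhs => rhs; rw [← h.right.decomp r.2]
    rw [h.right.lstar, h.right.star_mul_f]

theorem plus_mul_plus (h : IsSpinedSystem jL jR barL barR e f plus star st) {s : G} {u v : L}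
    (hu : u * jL (plus s) = u) (hu' : jL (plus s) * u = jL (plus s))
    (hv' : jL (plus s) * v = jL (plus s)) :
    μ (u, jR (plus s)) (v, jR (plus s)) = (u, jR (plus s)) := by
  have hst : st (jR (plus s)) v = plus s := h.left.inj (by rw [h.map_st, hv'])
  simp only [spinedMul, hst]
  rw [(h.left.eq_of_plus hu hu').2, hu, (h.right.map_eq _).2, ← h.right.map_mul,
    h.right.self_mul_star]

theorem star_mul_star (h : IsSpinedSystem jL jR barL barR e f plus star st) {s : G} {v w : R}
    (hv' : v * jR (star s) = jR (star s))
    (hw : jR (star s) * w = w) (hw' : w * jR (star s) = jR (star s)) :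
    μ (jL (star s), v) (jL (star s), w) = (jL (star s), w) := by
  have hst : st v (jL (star s)) = star s := h.right.inj (by rw [h.st_map, hv'])
  simp only [spinedMul, hst]
  rw [(h.right.eq_of_star hw hw').2, hw, (h.left.map_eq _).2, ← h.left.map_mul,
    h.left.plus_mul_self]

theorem plus_mul_map_mul_star (h : IsSpinedSystem jL jR barL barR e f plus star st) {s : G}
    {u : L} {w : R} (hu : u * jL (plus s) = u) (hu' : jL (plus s) * u = jL (plus s))
    (hw : jR (star s) * w = w) (hw' : w * jR (star s) = jR (star s)) :
    μ (μ (u, jR (plus s)) (jL s, jR s)) (jL (star s), w) = (u * jL s, jR s * w) := by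
  have h₁ : μ (u, jR (plus s)) (jL s, jR s) = (u * jL s, jR s) := by
    simp only [spinedMul, h.st_map_map, h.left.plus_mul_self]
    rw [(h.left.eq_of_plus hu hu').2, (h.right.map_eq s).2, ← h.right.map_mul,
      h.right.self_mul_star]
  rw [h₁]
  simp only [spinedMul, h.st_map_map, h.right.self_mul_star]
  rw [(h.left.unique s u hu hu').2, (h.right.eq_of_star hw hw').2]

theorem eq_of_left_plus (h : IsSpinedSystem jL jR barL barR e f plus star st) {s : G}
    {p : L × R} (hp : p ∈ T) (h₁ : μ p (jL (plus s), jR (plus s)) = p)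
    (h₂ : μ (jL (plus s), jR (plus s)) p = (jL (plus s), jR (plus s))) :
    p.1 * jL (plus s) = p.1 ∧ jL (plus s) * p.1 = jL (plus s) ∧ p = (p.1, jR (plus s)) := by
  have hu' : jL (plus s) * p.1 = jL (plus s) := by
    have := (h.left_mul_eq (h.map_mem (plus s)) p).1
    rw [h₂, (h.left.map_eq _).1] at this
    rw [← h.map_st, ← this]
  have hk : st p.2 (jL (plus s)) = barL p.1 := by
    have := (h.left_mul_eq hp (jL (plus s), jR (plus s))).1
    rw [h₁] at this
    exact this.symm
  have hp2 : jR (barL p.1) = p.2 := by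
    have h₃ := h.st_mul_star p.2 (jL (plus s))
    have h₄ : (μ p (jL (plus s), jR (plus s))).2 = p.2 := congrArg _ h₁
    rw [(h.left.map_eq _).1, hk] at h₃
    simp only [spinedMul, hk] at h₄
    rwa [(h.right.map_eq _).2, ← h.right.map_mul, h₃] at h₄
  have hu : p.1 * jL (plus s) = p.1 := by
    rw [← hp2, h.st_map_map] at hk
    rw [← h.left.decomp p.1, mul_assoc, ← h.left.map_mul, hk]
  exact ⟨hu, hu', Prod.ext rfl (by rw [← hp2, (h.left.eq_of_plus hu hu').1])⟩

theorem eq_of_right_star (h : IsSpinedSystem jL jR barL barR e f plus star st) {s : G}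
    {p : L × R} (hp : p ∈ T) (h₁ : μ (jL (star s), jR (star s)) p = p)
    (h₂ : μ p (jL (star s), jR (star s)) = (jL (star s), jR (star s))) :
    jR (star s) * p.2 = p.2 ∧ p.2 * jR (star s) = jR (star s) ∧ p = (jL (star s), p.2) := by
  have hw' : p.2 * jR (star s) = jR (star s) := by
    have := (h.right_mul_eq p (h.map_mem (star s))).1
    rw [h₂, (h.right.map_eq _).1] at this
    rw [← h.st_map, ← this]
  have hk : st (jR (star s)) p.1 = barR p.2 := by
    have := (h.right_mul_eq (jL (star s), jR (star s)) hp).1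
    rw [h₁] at this
    exact this.symm
  have hp1 : jL (barR p.2) = p.1 := by
    have h₃ := h.plus_mul_st (jR (star s)) p.1
    have h₄ : (μ (jL (star s), jR (star s)) p).1 = p.1 := congrArg _ h₁
    rw [(h.right.map_eq _).1, hk] at h₃
    simp only [spinedMul, hk] at h₄
    rwa [(h.left.map_eq _).2, ← h.left.map_mul, h₃] at h₄
  have hw : jR (star s) * p.2 = p.2 := by
    rw [← hp1, h.st_map_map] at hk
    rw [← h.right.decomp p.2, ← mul_assoc, ← h.right.map_mul, hk]
  exact ⟨hw, hw', Prod.ext (by rw [← hp1, (h.right.eq_of_star hw hw').1]) rfl⟩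

theorem quasiIdealOn (h : IsSpinedSystem jL jR barL barR e f plus star st) :
    QuasiIdealOn μ T (absT0 jL jR) := by
  rintro _ ⟨s, rfl⟩ r hr _ ⟨t, rfl⟩
  have hq : μ (jL s, jR s) r ∈ T := h.mul_mem (h.map_mem s) hr
  obtain ⟨k, hk⟩ : ∃ k, jL k = (μ (jL s, jR s) r).1 :=
    ⟨plus s * st (jR s) r.1, by simp only [spinedMul, (h.left.map_eq s).2, h.left.map_mul]⟩
  have hk' : k = barR (μ (jL s, jR s) r).2 := by
    rw [← show barL _ = barR _ from hq, ← hk, (h.left.map_eq k).1]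
  generalize μ (jL s, jR s) r = q at *
  refine ⟨st q.2 (jL t), Prod.ext ?_ ?_⟩
  · change e q.1 * jL (st q.2 (jL t)) = jL (st q.2 (jL t))
    rw [← hk, (h.left.map_eq k).2, ← h.left.map_mul, hk', h.plus_mul_st]
  · change jR (st q.2 (jL t)) * f (jR t) = jR (st q.2 (jL t))
    have := h.st_mul_star q.2 (jL t)
    rw [(h.left.map_eq t).1] at this
    rw [(h.right.map_eq t).2, ← h.right.map_mul, this]

theorem isoOn (h : IsSpinedSystem jL jR barL barR e f plus star st) :
    IsoOn (mulOf G) μ Set.univ (absT0 jL jR) :=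
  ⟨fun s => (jL s, jR s), ⟨fun s _ => ⟨s, rfl⟩,
    fun _ _ _ _ hst => h.left.inj (congrArg Prod.fst hst),
    fun _ ⟨s, hs⟩ => ⟨s, trivial, hs.symm⟩⟩, fun s _ t _ => (h.map_mul_map s t).symm⟩

theorem e_idem (h : IsSpinedSystem jL jR barL barR e f plus star st) (x : L) :
    Idem μ (e x, jR (plus (barL x))) :=
  h.plus_mul_plus (h.left.e_mul_plus x) (h.left.plus_mul_e x) (h.left.plus_mul_e x)

theorem f_idem (h : IsSpinedSystem jL jR barL barR e f plus star st) (a : R) :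
    Idem μ (jL (star (barR a)), f a) :=
  h.star_mul_star (h.right.f_mul_star a) (h.right.star_mul_f a) (h.right.f_mul_star a)

theorem abundantOn (h : IsSpinedSystem jL jR barL barR e f plus star st) :
    AbundantOn μ T := fun r hr =>
  ⟨⟨_, h.e_mem r.1, h.e_idem r.1, h.rstarOn hr⟩, ⟨_, h.f_mem r.2, h.f_idem r.2, h.lstarOn hr⟩⟩

end IsSpinedSystem

end SpinedProduct

section Green

variable {α : Type*} {mul : α → α → α} {U : Set α} {a b : α}

theorem GreenLOn.mul_eq (h : GreenLOn mul U a b) (hS : SemigroupOn mul U) (ha : a ∈ U)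
    (hb : b ∈ U) (hia : Idem mul a) (hib : Idem mul b) : mul a b = a ∧ mul b a = b := by
  obtain ⟨h₁, h₂⟩ := h
  constructor
  · rcases h₁ with rfl | ⟨u, hu, rfl⟩
    · exact hia
    · rw [hS.2 u hu b hb b hb, hib]
  · rcases h₂ with rfl | ⟨u, hu, rfl⟩
    · exact hib
    · rw [hS.2 u hu a ha a ha, hia]

theorem GreenROn.mul_eq (h : GreenROn mul U a b) (hS : SemigroupOn mul U) (ha : a ∈ U)
    (hb : b ∈ U) (hia : Idem mul a) (hib : Idem mul b) : mul b a = a ∧ mul a b = b := by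
  obtain ⟨h₁, h₂⟩ := h
  constructor
  · rcases h₁ with rfl | ⟨u, hu, rfl⟩
    · exact hia
    · rw [← hS.2 b hb b hb u hu, hib]
  · rcases h₂ with rfl | ⟨u, hu, rfl⟩
    · exact hib
    · rw [← hS.2 a ha a ha u hu, hia]

theorem greenLOn_of_mul_eq (ha : a ∈ U) (hb : b ∈ U) (h₁ : mul a b = a) (h₂ : mul b a = b) :
    GreenLOn mul U a b :=
  ⟨Or.inr ⟨a, ha, h₁⟩, Or.inr ⟨b, hb, h₂⟩⟩

theorem greenROn_of_mul_eq (ha : a ∈ U) (hb : b ∈ U) (h₁ : mul b a = a) (h₂ : mul a b = b) :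
    GreenROn mul U a b :=
  ⟨Or.inr ⟨a, ha, h₁⟩, Or.inr ⟨b, hb, h₂⟩⟩

theorem semigroupOn_mulOf (S : Type*) [Semigroup S] : SemigroupOn (mulOf S) Set.univ :=
  ⟨fun _ _ _ _ => trivial, fun a _ b _ c _ => mul_assoc a b c⟩

end Green

section Construction

variable {L R G : Type*} [Semigroup L] [Semigroup R] [Semigroup G]

/-- The adequate transversal `{(s,s)}` of the spined product. -/
def IsSpinedSystem.transversal {jL : G → L} {jR : G → R} {barL : L → G} {barR : R → G}
    {e : L → L} {f : R → R} {plus star : G → G} {st : R → L → G}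
    (h : IsSpinedSystem jL jR barL barR e f plus star st)
    (hG : ∀ s t : G, s * s = s → t * t = t → s * t = t * s) :
    AdequateTransversalOn (spinedMul jL jR e f st) (spinedSet barL barR) (absT0 jL jR) where
  sub := by rintro _ ⟨s, rfl⟩; exact h.map_mem s
  mul_mem := by
    rintro _ ⟨s, rfl⟩ _ ⟨t, rfl⟩
    exact ⟨s * t, h.map_mul_map s t⟩
  bar p := (jL (barL p.1), jR (barL p.1))
  e p := (e p.1, jR (plus (barL p.1)))
  f p := (jL (star (barR p.2)), f p.2)
  plus p := (jL (plus (barL p.1)), jR (plus (barL p.1)))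
  star p := (jL (star (barR p.2)), jR (star (barR p.2)))
  plus_mem _ _ := ⟨_, rfl⟩
  plus_idem _ _ := by rw [Idem, h.map_mul_map, h.left.plus_mul_plus]
  plus_rstar := by
    rintro _ ⟨s, rfl⟩
    have := h.rstarOn (h.map_mem s)
    simpa only [(h.left.map_eq s).1, (h.left.map_eq s).2] using this
  star_mem _ _ := ⟨_, rfl⟩
  star_idem _ _ := by rw [Idem, h.map_mul_map, h.right.star_mul_star]
  star_lstar := by
    rintro _ ⟨s, rfl⟩
    have := h.lstarOn (h.map_mem s)
    simpa only [(h.right.map_eq s).1, (h.right.map_eq s).2] using this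
  idem_comm := by
    rintro _ ⟨s, rfl⟩ _ ⟨t, rfl⟩ hs ht
    rw [Idem, h.map_mul_map] at hs ht
    rw [h.map_mul_map, h.map_mul_map, hG s t (h.left.inj (congrArg Prod.fst hs))
      (h.left.inj (congrArg Prod.fst ht))]
  bar_mem _ _ := ⟨_, rfl⟩
  e_mem p _ := h.e_mem p.1
  f_mem p _ := h.f_mem p.2
  e_idem p _ := h.e_idem p.1
  f_idem p _ := h.f_idem p.2
  decomp p hp := by
    have hb : barR p.2 = barL p.1 := Eq.symm hp
    have hf := h.right.star_mul_f p.2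
    have hf' := h.right.f_mul_star p.2
    have hd := h.right.decomp p.2
    rw [hb] at hf hf' hd ⊢
    rw [h.plus_mul_map_mul_star (h.left.e_mul_plus p.1) (h.left.plus_mul_e p.1) hf hf',
      h.left.decomp, hd]
  e_greenL p _ := by
    have hs := (h.left.map_eq (barL p.1)).1
    have hi : jL (plus (barL p.1)) * jL (plus (barL p.1)) = jL (plus (barL p.1)) := by
      rw [← h.left.map_mul, h.left.plus_mul_plus]
    simp only [hs]
    exact greenLOn_of_mul_eq (h.e_mem _) (h.map_mem _)
      (h.plus_mul_plus (h.left.e_mul_plus _) (h.left.plus_mul_e _) hi)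
      (h.plus_mul_plus hi hi (h.left.plus_mul_e _))
  f_greenR p hp := by
    have hs := (h.right.map_eq (barR p.2)).1
    have hi : jR (star (barR p.2)) * jR (star (barR p.2)) = jR (star (barR p.2)) := by
      rw [← h.right.map_mul, h.right.star_mul_star]
    simp only [show barL p.1 = barR p.2 from hp, hs]
    exact greenROn_of_mul_eq (h.f_mem _) (h.map_mem _)
      (h.star_mul_star hi (h.right.star_mul_f _) (h.right.f_mul_star _))
      (h.star_mul_star (h.right.f_mul_star _) hi hi)
  unique := by
    rintro r hr _ ⟨s, rfl⟩ p hp q hq hip hiq hrpq hpl hqr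
    simp only [(h.left.map_eq s).1] at hpl
    simp only [(h.right.map_eq s).1] at hqr
    obtain ⟨hp₁, hp₂⟩ := hpl.mul_eq h.semigroupOn hp (h.map_mem _) hip
      (by rw [Idem, h.map_mul_map, h.left.plus_mul_plus])
    obtain ⟨hq₁, hq₂⟩ := hqr.mul_eq h.semigroupOn hq (h.map_mem _) hiq
      (by rw [Idem, h.map_mul_map, h.right.star_mul_star])
    obtain ⟨hu, hu', hpe⟩ := h.eq_of_left_plus hp hp₁ hp₂
    obtain ⟨hw, hw', hqe⟩ := h.eq_of_right_star hq hq₁ hq₂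
    rw [hpe, hqe, h.plus_mul_map_mul_star hu hu' hw hw'] at hrpq
    subst hrpq
    obtain ⟨hb, he⟩ := h.left.unique s _ hu hu'
    obtain ⟨hb', hf⟩ := h.right.unique s _ hw hw'
    simp only [hb, hb', he, hf]
    exact ⟨trivial, hpe, hqe⟩

theorem AdequateTransversalOn.exists_isLeftTransversal {j : G → L}
    (hj : Function.Injective j) (hjm : ∀ s t : G, j (s * t) = j s * j t)
    (hL : LeftAdequateOn (mulOf L) Set.univ)
    (A : AdequateTransversalOn (mulOf L) Set.univ (Set.range j)) :
    ∃ (bar : L → G) (plus : G → G), (∀ x, j (bar x) = A.bar x) ∧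
      IsLeftTransversal j bar A.e plus := by
  choose bar hbar using fun x => A.bar_mem x trivial
  choose plus hplus using fun s => A.plus_mem (j s) ⟨s, rfl⟩
  have hpp : ∀ s, plus s * plus s = plus s := fun s =>
    hj (by rw [hjm, hplus]; exact A.plus_idem (j s) ⟨s, rfl⟩)
  have hcomm : ∀ s t : G, s * s = s → t * t = t → s * t = t * s := fun s t hs ht =>
    hj (by
      rw [hjm, hjm]
      exact A.idem_comm _ ⟨s, rfl⟩ _ ⟨t, rfl⟩ (by rw [Idem, mulOf, ← hjm, hs])
        (by rw [Idem, mulOf, ← hjm, ht]))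
  have hR : ∀ s, RStarOn (mulOf L) Set.univ (j s) (j (plus s)) := fun s => by
    rw [hplus]; exact A.plus_rstar (j s) ⟨s, rfl⟩
  have hps : ∀ s, plus s * s = s := fun s => hj (by
    rw [hjm]
    refine ((hR s).2 (j (plus s)) trivial).2 ?_
    rw [mulOf, ← hjm, hpp])
  have hf : ∀ x, A.f x = A.star (A.bar x) := fun x => by
    refine hL.2 _ trivial _ trivial (A.f_idem x trivial)
      (A.star_idem _ (A.bar_mem x trivial)) ?_
    obtain ⟨h₁, h₂⟩ := (A.f_greenR x trivial).mul_eq (semigroupOn_mulOf L) trivial trivial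
      (A.f_idem x trivial) (A.star_idem _ (A.bar_mem x trivial))
    simp only [mulOf] at h₁ h₂
    refine ⟨fun y _ z _ => ⟨fun hyz => ?_, fun hyz => ?_⟩,
      fun y _ => ⟨fun hy => ?_, fun hy => ?_⟩⟩ <;> simp only [mulOf] at *
    · rw [← h₂, ← mul_assoc, hyz, mul_assoc]
    · rw [← h₁, ← mul_assoc, hyz, mul_assoc]
    · rw [← h₂, ← mul_assoc, hy]
    · rw [← h₁, ← mul_assoc, hy]
  have hs : ∀ s : G, j s * A.star (j s) = j s := fun s =>
    ((A.star_lstar (j s) ⟨s, rfl⟩).2 _ trivial).2 (A.star_idem (j s) ⟨s, rfl⟩)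
  have he : ∀ x, A.e x * j (plus (bar x)) = A.e x ∧
      j (plus (bar x)) * A.e x = j (plus (bar x)) := fun x => by
    rw [hplus, hbar]
    exact (A.e_greenL x trivial).mul_eq (semigroupOn_mulOf L) trivial trivial
      (A.e_idem x trivial) (A.plus_idem _ (A.bar_mem x trivial))
  refine ⟨bar, plus, hbar, hj, hjm, fun s t => hcomm _ _ (hpp s) (hpp t), hpp, hps,
    fun s => ?_, fun s x y => (hR s).1 x trivial y trivial, fun x => ?_,
    fun x => (he x).1, fun x => (he x).2, fun s u hu hu' => ?_⟩
  · have h₁ : plus s * plus (plus s) = plus (plus s) := hj (by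
      rw [hjm]
      refine ((hR (plus s)).2 (j (plus s)) trivial).1 ?_
      rw [mulOf, ← hjm, hpp])
    rw [← h₁, hcomm _ _ (hpp s) (hpp _), hps]
  · have := A.decomp x trivial
    simp only [mulOf] at this
    rw [hf, ← hbar, mul_assoc, hs] at this
    exact this.symm
  · have hi : u * u = u := by
      conv_lhs => lhs; rw [← hu]
      rw [mul_assoc, hu', hu]
    obtain ⟨h₁, h₂, -⟩ := A.unique (u * j s) trivial (j s) ⟨s, rfl⟩ u trivial
      (A.star (j s)) trivial hi (A.star_idem _ ⟨s, rfl⟩)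
      (by simp only [mulOf]; rw [mul_assoc, hs])
      (greenLOn_of_mul_eq trivial trivial (by rw [← hplus]; exact hu)
        (by rw [← hplus]; exact hu'))
      ⟨Or.inl rfl, Or.inl rfl⟩
    exact ⟨hj (by rw [hbar, ← h₁]), h₂.symm⟩

theorem AdequateTransversalOn.exists_isRightTransversal {j : G → R}
    (hj : Function.Injective j) (hjm : ∀ s t : G, j (s * t) = j s * j t)
    (hR : RightAdequateOn (mulOf R) Set.univ)
    (A : AdequateTransversalOn (mulOf R) Set.univ (Set.range j)) :
    ∃ (bar : R → G) (star : G → G), (∀ x, j (bar x) = A.bar x) ∧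
      IsRightTransversal j bar A.f star := by
  choose bar hbar using fun x => A.bar_mem x trivial
  choose star hstar using fun s => A.star_mem (j s) ⟨s, rfl⟩
  have hpp : ∀ s, star s * star s = star s := fun s =>
    hj (by rw [hjm, hstar]; exact A.star_idem (j s) ⟨s, rfl⟩)
  have hcomm : ∀ s t : G, s * s = s → t * t = t → s * t = t * s := fun s t hs ht =>
    hj (by
      rw [hjm, hjm]
      exact A.idem_comm _ ⟨s, rfl⟩ _ ⟨t, rfl⟩ (by rw [Idem, mulOf, ← hjm, hs])
        (by rw [Idem, mulOf, ← hjm, ht]))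
  have hL : ∀ s, LStarOn (mulOf R) Set.univ (j s) (j (star s)) := fun s => by
    rw [hstar]; exact A.star_lstar (j s) ⟨s, rfl⟩
  have hps : ∀ s, s * star s = s := fun s => hj (by
    rw [hjm]
    refine ((hL s).2 (j (star s)) trivial).2 ?_
    rw [mulOf, ← hjm, hpp])
  have he : ∀ x, A.e x = A.plus (A.bar x) := fun x => by
    refine hR.2 _ trivial _ trivial (A.e_idem x trivial)
      (A.plus_idem _ (A.bar_mem x trivial)) ?_
    obtain ⟨h₁, h₂⟩ := (A.e_greenL x trivial).mul_eq (semigroupOn_mulOf R) trivial trivial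
      (A.e_idem x trivial) (A.plus_idem _ (A.bar_mem x trivial))
    simp only [mulOf] at h₁ h₂
    refine ⟨fun y _ z _ => ⟨fun hyz => ?_, fun hyz => ?_⟩,
      fun y _ => ⟨fun hy => ?_, fun hy => ?_⟩⟩ <;> simp only [mulOf] at *
    · rw [← h₂, mul_assoc, hyz, mul_assoc]
    · rw [← h₁, mul_assoc, hyz, mul_assoc]
    · rw [← h₂, mul_assoc, hy]
    · rw [← h₁, mul_assoc, hy]
  have hp : ∀ s : G, A.plus (j s) * j s = j s := fun s =>
    ((A.plus_rstar (j s) ⟨s, rfl⟩).2 _ trivial).2 (A.plus_idem (j s) ⟨s, rfl⟩)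
  have hf : ∀ x, j (star (bar x)) * A.f x = A.f x ∧
      A.f x * j (star (bar x)) = j (star (bar x)) := fun x => by
    rw [hstar, hbar]
    exact (A.f_greenR x trivial).mul_eq (semigroupOn_mulOf R) trivial trivial
      (A.f_idem x trivial) (A.star_idem _ (A.bar_mem x trivial))
  refine ⟨bar, star, hbar, hj, hjm, fun s t => hcomm _ _ (hpp s) (hpp t), hpp, hps,
    fun s => ?_, fun s x y => (hL s).1 x trivial y trivial, fun x => ?_,
    fun x => (hf x).1, fun x => (hf x).2, fun s w hw hw' => ?_⟩
  · have h₁ : star (star s) * star s = star (star s) := hj (by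
      rw [hjm]
      refine ((hL (star s)).2 (j (star s)) trivial).1 ?_
      rw [mulOf, ← hjm, hpp])
    rw [← h₁, hcomm _ _ (hpp _) (hpp s), hps]
  · have := A.decomp x trivial
    simp only [mulOf] at this
    rw [he, ← hbar, hp] at this
    exact this.symm
  · have hi : w * w = w := by
      conv_lhs => rhs; rw [← hw]
      rw [← mul_assoc, hw', hw]
    obtain ⟨h₁, -, h₂⟩ := A.unique (j s * w) trivial (j s) ⟨s, rfl⟩ (A.plus (j s)) trivial
      w trivial (A.plus_idem _ ⟨s, rfl⟩) hi
      (by simp only [mulOf]; rw [hp])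
      ⟨Or.inl rfl, Or.inl rfl⟩
      (greenROn_of_mul_eq trivial trivial (by rw [← hstar]; exact hw)
        (by rw [← hstar]; exact hw'))
    exact ⟨hj (by rw [hbar, ← h₁]), h₂.symm⟩

end Construction

end Paper

open Paper in
/-- **Theorem main, direct part.** Given a common quasi-ideal
adequate transversal `S⁰` (the type `G`) of a left adequate `L` and a right
adequate `R`, and `∗ : R × L → S⁰` satisfying (1) and (2), the spined product
`T = {(x,a) : x̄ = ā}` with `(x,a)(y,b) = (e_x(a∗y), (a∗y)f_b)` is an abundant
semigroup and `T⁰ = {(s,s)}` is a quasi-ideal adequate transversal of `T`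
isomorphic to `S⁰`. -/
theorem stmt8 {L R G : Type u} [Semigroup L] [Semigroup R] [Semigroup G]
    (jL : G → L) (jR : G → R)
    (hjL : Function.Injective jL) (hjR : Function.Injective jR)
    (hjLm : ∀ s t : G, jL (s * t) = jL s * jL t)
    (hjRm : ∀ s t : G, jR (s * t) = jR s * jR t)
    (hG : AdequateOn (mulOf G) Set.univ)
    (hL : LeftAdequateOn (mulOf L) Set.univ)
    (hR : RightAdequateOn (mulOf R) Set.univ)
    (TL : AdequateTransversalOn (mulOf L) Set.univ (Set.range jL))
    (TR : AdequateTransversalOn (mulOf R) Set.univ (Set.range jR))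
    (hQL : QuasiIdealOn (mulOf L) Set.univ (Set.range jL))
    (hQR : QuasiIdealOn (mulOf R) Set.univ (Set.range jR))
    (st : R → L → G)
    (cond1 : ∀ (y z : L) (a b : R),
      (∃ s : G, jL s = TL.bar y ∧ jR s = TR.bar b) →
      st (jR (st a y) * TR.f b) z = st a (TL.e y * jL (st b z)))
    (cond2L : ∀ (s : G) (x : L), jL (st (jR s) x) = jL s * x)
    (cond2R : ∀ (a : R) (s : G), jR (st a (jL s)) = a * jR s)
    :
    SemigroupOn (absMul TL TR st) (absTset TL TR) ∧
    AbundantOn (absMul TL TR st) (absTset TL TR) ∧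
    Nonempty (AdequateTransversalOn (absMul TL TR st) (absTset TL TR) (absT0 jL jR)) ∧
    QuasiIdealOn (absMul TL TR st) (absTset TL TR) (absT0 jL jR) ∧
    IsoOn (mulOf G) (absMul TL TR st) Set.univ (absT0 jL jR) := by
  obtain ⟨barL, plus, hbarL, hleft⟩ := TL.exists_isLeftTransversal hjL hjLm hL
  obtain ⟨barR, star, hbarR, hright⟩ := TR.exists_isRightTransversal hjR hjRm hR
  have hmem (x : L) (a : R) : (∃ s : G, jL s = TL.bar x ∧ jR s = TR.bar a) ↔
      barL x = barR a := by
    rw [← hbarL, ← hbarR]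
    exact ⟨fun ⟨s, h₁, h₂⟩ => (hjL h₁).symm.trans (hjR h₂), fun h => ⟨barL x, rfl, by rw [h]⟩⟩
  have h : IsSpinedSystem jL jR barL barR TL.e TR.f plus star st :=
    ⟨hleft, hright, fun y z a b hyb => cond1 y z a b ((hmem y b).2 hyb), cond2L, cond2R⟩
  have hT : absTset TL TR = spinedSet barL barR := Set.ext fun p => hmem p.1 p.2
  have hM : absMul TL TR st = spinedMul jL jR TL.e TR.f st := rfl
  rw [hT, hM]
  exact ⟨h.semigroupOn, h.abundantOn,
    ⟨h.transversal fun s t => hG.2 s trivial t trivial⟩, h.quasiIdealOn, h.isoOn⟩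
end
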